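/- arXiv:1107.5533 — 2 statements merged into one kernel-verified Lean document; each statement's English description precedes it below -/
import Mathlib

section
/- Let H be a connected graded commutative Hopf algebra over ℂ and let A be a commutative ℂ-algebra with a linear idempotent projection π onto a subalgebra A₋ along a subalgebra A₊ (so π is Rota-Baxter of weight 1). Then every algebra homomorphism φ: H → A admits a unique Birkhoff decomposition φ = φ₋^{⋆−1} ⋆ φ₊ (convolution product and convolution inverse), where φ₋, φ₊: H → A are algebra homomorphisms with φ₋(1) = 1, φ₋(x) ∈ A₋ for all x in the augmentation ideal, and φ₊(x) ∈ A₊ for all x in the augmentation ideal; φ₋ and φ₊ are given recursively on the augmentation ideal by φ₋(Γ) = −π(φ(Γ) + Σ φ₋(γ')φ(γ'')) and φ₊(Γ) = (id − π)(φ(Γ) + Σ φ₋(γ')φ(γ'')), summing over the reduced coproduct Δ'(Γ) = Σ γ' ⊗ γ''. -/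
open TensorProduct

variable {H A : Type*} [CommRing H] [HopfAlgebra ℂ H] [CommRing A] [Algebra ℂ A]

/-- Convolution product of linear maps `H → A`: `f ⋆ g = m_A ∘ (f ⊗ g) ∘ Δ`. -/
noncomputable def conv (f g : H →ₗ[ℂ] A) : H →ₗ[ℂ] A :=
  (LinearMap.mul' ℂ A) ∘ₗ (TensorProduct.map f g) ∘ₗ (Coalgebra.comul (R := ℂ) (A := H))

noncomputable section
namespace DeRham

variable (k R : Type*) [Field k] [CommRing R] [Algebra k R]

/-- The algebra of Kähler differential forms. -/
abbrev Forms : Type _ := ExteriorAlgebra R (Ω[R⁄k])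

/-- Pairs of forms, with the twisted scalar action `h • (a, b) = (h a, h b + dh a)`; the graph of
the exterior derivative is linear for this action. -/
@[ext] structure Jet where
  fst : Forms k R
  snd : Forms k R

variable {R}

/-- The exact one-form `dh`. -/
def dOne (h : R) : Forms k R := ExteriorAlgebra.ι R (KaehlerDifferential.D k R h)

lemma dOne_add (g h : R) : dOne k (g + h) = dOne k g + dOne k h := by simp [dOne]

lemma dOne_mul (g h : R) : dOne k (g * h) = g • dOne k h + h • dOne k g := by simp [dOne]

lemma dOne_smul (c : k) (h : R) : dOne k (c • h) = c • dOne k h := by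
  simp only [dOne, Derivation.map_smul]
  rw [← algebraMap_smul R c, map_smul, algebraMap_smul]

lemma dOne_mul_dOne_add (g h : R) : dOne k g * dOne k h + dOne k h * dOne k g = 0 :=
  ExteriorAlgebra.ι_add_mul_swap _ _

lemma dOne_mul_self (g : R) : dOne k g * dOne k g = 0 := ExteriorAlgebra.ι_sq_zero _

variable {k}

namespace Jet

instance : AddCommGroup (Jet k R) :=
  Equiv.addCommGroup (β := Forms k R × Forms k R)
    ⟨fun x => (x.1, x.2), fun x => ⟨x.1, x.2⟩, fun _ => rfl, fun _ => rfl⟩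

@[simp] lemma add_fst (x y : Jet k R) : (x + y).fst = x.fst + y.fst := rfl
@[simp] lemma add_snd (x y : Jet k R) : (x + y).snd = x.snd + y.snd := rfl
@[simp] lemma zero_fst : (0 : Jet k R).fst = 0 := rfl
@[simp] lemma zero_snd : (0 : Jet k R).snd = 0 := rfl

instance : SMul R (Jet k R) where
  smul h x := ⟨h • x.fst, h • x.snd + dOne k h * x.fst⟩

@[simp] lemma smul_fst (h : R) (x : Jet k R) : (h • x).fst = h • x.fst := rfl
@[simp] lemma smul_snd (h : R) (x : Jet k R) :
    (h • x).snd = h • x.snd + dOne k h * x.fst := rfl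

instance : Module R (Jet k R) where
  one_smul x := by ext <;> simp [dOne]
  mul_smul g h x := by
    ext
    · simp [mul_smul]
    · simp [mul_smul, dOne_mul, add_mul, add_assoc]
  smul_zero h := by ext <;> simp
  smul_add h x y := by
    ext
    · simp
    · simp only [smul_snd, add_snd, add_fst, smul_add, mul_add]; abel
  add_smul g h x := by
    ext
    · simp [add_smul]
    · simp only [smul_snd, add_snd, add_smul, dOne_add, add_mul]; abel
  zero_smul x := by ext <;> simp [dOne]

instance : Module k (Jet k R) := Module.compHom _ (algebraMap k R)

instance : IsScalarTower k R (Jet k R) := IsScalarTower.of_algebraMap_smul fun _ _ => rfl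

@[simp] lemma base_smul_fst (c : k) (x : Jet k R) : (c • x).fst = c • x.fst :=
  algebraMap_smul R c x.fst

@[simp] lemma base_smul_snd (c : k) (x : Jet k R) : (c • x).snd = c • x.snd := by
  change (algebraMap k R c) • x.snd + dOne k (algebraMap k R c) * x.fst = _
  simp [dOne]

variable (k) in
/-- Left multiplication by `dh` on the graph of the exterior derivative. -/
def mulD (h : R) : Jet k R →ₗ[R] Jet k R where
  toFun x := ⟨dOne k h * x.fst, -(dOne k h * x.snd)⟩
  map_add' x y := by
    ext
    · simp [mul_add]
    · simp only [add_snd, mul_add]; abel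
  map_smul' g x := by
    ext
    · simp
    · simp only [smul_snd, mul_add, RingHom.id_apply, mul_smul_comm, smul_neg,
        ← mul_assoc]
      rw [eq_neg_of_add_eq_zero_left (dOne_mul_dOne_add k h g)]
      simp only [neg_mul]; abel

@[simp] lemma mulD_fst (h : R) (x : Jet k R) : (mulD k h x).fst = dOne k h * x.fst := rfl
@[simp] lemma mulD_snd (h : R) (x : Jet k R) : (mulD k h x).snd = -(dOne k h * x.snd) := rfl

variable (k R) in
/-- `mulD` as a derivation. -/
def mulDerivation : Derivation k R (Jet k R →ₗ[R] Jet k R) where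
  toFun := mulD k
  map_add' g h := by ext x <;> simp [dOne_add, add_mul]; abel
  map_smul' c h := by
    ext x <;> simp [dOne_smul]
  map_one_eq_zero' := by ext x <;> simp [dOne]
  leibniz' g h := by
    ext x
    · simp [dOne_mul, add_mul]
    · simp only [mulD_snd, dOne_mul, LinearMap.add_apply, LinearMap.smul_apply, add_snd, smul_snd,
        mulD_fst, LinearMap.coe_mk, AddHom.coe_mk, ← mul_assoc, add_mul, smul_mul_assoc,
        eq_neg_of_add_eq_zero_left (dOne_mul_dOne_add k h g)]
      simp only [neg_mul, smul_neg]; abel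

@[simp] lemma mulDerivation_apply (h : R) : mulDerivation k R h = mulD k h := rfl

lemma mulDerivation_lift_anticomm (ω η : Ω[R⁄k]) (x : Jet k R) :
    (mulDerivation k R).liftKaehlerDifferential ω
        ((mulDerivation k R).liftKaehlerDifferential η x) +
      (mulDerivation k R).liftKaehlerDifferential η
        ((mulDerivation k R).liftKaehlerDifferential ω x) = 0 := by
  have hω : ω ∈ Submodule.span R (Set.range (KaehlerDifferential.D k R)) := by
    rw [KaehlerDifferential.span_range_derivation]; trivial
  have hη : η ∈ Submodule.span R (Set.range (KaehlerDifferential.D k R)) := by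
    rw [KaehlerDifferential.span_range_derivation]; trivial
  induction hω using Submodule.span_induction with
  | zero => simp
  | add a b _ _ ha hb =>
    rw [map_add, LinearMap.add_apply, LinearMap.add_apply, map_add, add_add_add_comm, ha, hb,
      add_zero]
  | smul r a _ ha =>
    rw [map_smul, LinearMap.smul_apply, LinearMap.smul_apply, map_smul, ← smul_add, ha, smul_zero]
  | mem _ hg =>
    obtain ⟨g, rfl⟩ := hg
    induction hη using Submodule.span_induction with
    | zero => simp
    | add a b _ _ ha hb =>
      rw [map_add, LinearMap.add_apply, LinearMap.add_apply, map_add, add_add_add_comm, ha, hb,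
        add_zero]
    | smul r a _ ha =>
      rw [map_smul, LinearMap.smul_apply, LinearMap.smul_apply, map_smul, ← smul_add, ha,
        smul_zero]
    | mem _ hh =>
      obtain ⟨h, rfl⟩ := hh
      ext <;> simp [← mul_assoc, ← add_mul, dOne_mul_dOne_add]

lemma mulDerivation_lift_sq [CharZero k] (ω : Ω[R⁄k]) (x : Jet k R) :
    (mulDerivation k R).liftKaehlerDifferential ω
      ((mulDerivation k R).liftKaehlerDifferential ω x) = 0 := by
  have h := mulDerivation_lift_anticomm ω ω x
  rw [← two_smul k] at h
  exact (smul_eq_zero_iff_right two_ne_zero).mp h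

end Jet

/-- Forms are generated by `1` under addition and left multiplication by functions and by exact
one-forms. -/
@[elab_as_elim]
lemma forms_induction {p : Forms k R → Prop} (one : p 1)
    (add : ∀ v w, p v → p w → p (v + w)) (smul : ∀ (h : R) w, p w → p (h • w))
    (dOne_mul : ∀ (h : R) w, p w → p (dOne k h * w)) (w : Forms k R) : p w := by
  induction w using CliffordAlgebra.left_induction with
  | algebraMap r => rw [Algebra.algebraMap_eq_smul_one]; exact smul _ _ one
  | add v w hv hw => exact add v w hv hw
  | ι_mul w ω hw =>
    have hω : ω ∈ Submodule.span R (Set.range (KaehlerDifferential.D k R)) := by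
      rw [KaehlerDifferential.span_range_derivation]; trivial
    induction hω using Submodule.span_induction with
    | zero => simpa using smul 0 _ one
    | add a b _ _ ha hb => rw [map_add, add_mul]; exact add _ _ ha hb
    | smul r a _ ha => rw [map_smul, smul_mul_assoc]; exact smul _ _ ha
    | mem _ hg =>
      obtain ⟨g, rfl⟩ := hg
      exact dOne_mul g w hw

variable (X : Derivation k R R)

/-- Contraction of forms with a vector field. -/
def contract : Forms k R →ₗ[R] Forms k R :=
  CliffordAlgebra.contractLeft X.liftKaehlerDifferential

@[simp] lemma contract_one : contract X 1 = 0 := CliffordAlgebra.contractLeft_one _ _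

lemma contract_dOne_mul (h : R) (w : Forms k R) :
    contract X (dOne k h * w) = X h • w - dOne k h * contract X w := by
  unfold contract dOne ExteriorAlgebra.ι
  rw [CliffordAlgebra.contractLeft_ι_mul, Derivation.liftKaehlerDifferential_comp_D]

lemma contract_contract (w : Forms k R) : contract X (contract X w) = 0 :=
  CliffordAlgebra.contractLeft_contractLeft _ _

variable [CharZero k]

variable (k R) in
/-- A form together with its exterior derivative. -/
def jet : Forms k R →ₗ[R] Jet k R :=
  CliffordAlgebra.foldr (0 : QuadraticForm R (Ω[R⁄k]))
    (Jet.mulDerivation k R).liftKaehlerDifferential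
    (fun ω x => by simpa using Jet.mulDerivation_lift_sq ω x) ⟨1, 0⟩

lemma jet_one : jet k R 1 = ⟨1, 0⟩ := CliffordAlgebra.foldr_one _ _ _ _

lemma jet_dOne_mul (h : R) (w : Forms k R) : jet k R (dOne k h * w) = Jet.mulD k h (jet k R w) := by
  unfold jet dOne ExteriorAlgebra.ι
  rw [CliffordAlgebra.foldr_mul, CliffordAlgebra.foldr_ι,
    Derivation.liftKaehlerDifferential_comp_D, Jet.mulDerivation_apply]

lemma jet_fst (w : Forms k R) : (jet k R w).fst = w := by
  induction w using forms_induction with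
  | one => rw [jet_one]
  | add v w hv hw => rw [map_add, Jet.add_fst, hv, hw]
  | smul h w hw => rw [map_smul, Jet.smul_fst, hw]
  | dOne_mul h w hw => rw [jet_dOne_mul, Jet.mulD_fst, hw]

variable (k R) in
/-- The exterior derivative. -/
def d : Forms k R →ₗ[k] Forms k R where
  toFun w := (jet k R w).snd
  map_add' v w := by simp
  map_smul' c w := by
    rw [← algebraMap_smul R c, map_smul, algebraMap_smul]
    simp

@[simp] lemma d_one : d k R 1 = 0 := by simp [d, jet_one]

lemma d_smul (h : R) (w : Forms k R) : d k R (h • w) = h • d k R w + dOne k h * w := by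
  simp [d, jet_fst]

lemma d_dOne_mul (h : R) (w : Forms k R) : d k R (dOne k h * w) = -(dOne k h * d k R w) := by
  simp [d, jet_dOne_mul]

lemma d_d (w : Forms k R) : d k R (d k R w) = 0 := by
  induction w using forms_induction with
  | one => simp
  | add v w hv hw => simp [hv, hw]
  | smul h w hw => simp [d_smul, d_dOne_mul, hw]
  | dOne_mul h w hw => simp [d_dOne_mul, hw]

/-- The Lie derivative of forms along a vector field. -/
def lieD : Forms k R →ₗ[k] Forms k R :=
  d k R ∘ₗ (contract X).restrictScalars k + (contract X).restrictScalars k ∘ₗ d k R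

lemma lieD_apply (w : Forms k R) : lieD X w = d k R (contract X w) + contract X (d k R w) := rfl

@[simp] lemma lieD_one : lieD X 1 = 0 := by simp [lieD_apply]

lemma lieD_smul (h : R) (w : Forms k R) : lieD X (h • w) = h • lieD X w + X h • w := by
  simp only [lieD_apply, map_smul, d_smul, map_add, contract_dOne_mul, smul_add]; abel

lemma lieD_dOne_mul (h : R) (w : Forms k R) :
    lieD X (dOne k h * w) = dOne k h * lieD X w + dOne k (X h) * w := by
  simp only [lieD_apply, d_smul, map_neg, map_sub, d_dOne_mul, contract_dOne_mul, mul_add]; abel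

lemma lieD_d (w : Forms k R) : lieD X (d k R w) = d k R (lieD X w) := by
  simp [lieD_apply, d_d]

lemma lieD_contract (w : Forms k R) : lieD X (contract X w) = contract X (lieD X w) := by
  simp [lieD_apply, contract_contract]

/-- The degree-zero part of a derivative vanishes. -/
lemma algebraMapInv_d (w : Forms k R) : ExteriorAlgebra.algebraMapInv (d k R w) = 0 := by
  induction w using forms_induction with
  | one => simp
  | add v w hv hw => simp [hv, hw]
  | smul h w hw =>
    have h1 : ExteriorAlgebra.algebraMapInv (dOne k h) = 0 := by
      simp [dOne, ExteriorAlgebra.algebraMapInv]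
    simp [d_smul, hw, h1]
  | dOne_mul h w hw => simp [d_dOne_mul, hw]

lemma d_ne_one [Nontrivial R] (w : Forms k R) : d k R w ≠ 1 := fun h => by
  simpa [h] using algebraMapInv_d w


section Diagonalizable

variable {K V : Type*} [Field K] [AddCommGroup V] [Module K V] (T : Module.End K V)

/-- The sum of the eigenspaces for nonzero eigenvalues. -/
def nonzeroEigen : Submodule K V := ⨆ μ ≠ (0 : K), T.eigenspace μ

variable {T}

lemma mem_nonzeroEigen {μ : K} (hμ : μ ≠ 0) {v : V} (hv : T v = μ • v) : v ∈ nonzeroEigen T :=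
  Submodule.mem_iSup_of_mem μ (Submodule.mem_iSup_of_mem hμ (Module.End.mem_eigenspace_iff.mpr hv))

lemma eq_zero_of_mem_nonzeroEigen {v : V} (hv : v ∈ nonzeroEigen T) (h : T v = 0) : v = 0 := by
  have h0 : v ∈ T.eigenspace 0 := by rw [Module.End.mem_eigenspace_iff, h, zero_smul]
  exact Submodule.disjoint_def.mp (T.eigenspaces_iSupIndep 0) v h0 hv

lemma nonzeroEigen_le_range : nonzeroEigen T ≤ LinearMap.range T := by
  refine iSup₂_le fun μ hμ v hv => ⟨μ⁻¹ • v, ?_⟩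
  rw [map_smul, Module.End.mem_eigenspace_iff.mp hv, inv_smul_smul₀ hμ]

lemma apply_mem_nonzeroEigen {v : V} (hv : v ∈ nonzeroEigen T) : T v ∈ nonzeroEigen T := by
  suffices h : nonzeroEigen T ≤ (nonzeroEigen T).comap T from h hv
  refine iSup₂_le fun μ hμ v hv => mem_nonzeroEigen hμ ?_
  rw [Module.End.mem_eigenspace_iff.mp hv, map_smul, Module.End.mem_eigenspace_iff.mp hv]

lemma apply_eq_zero_of_sq (h : LinearMap.ker T ⊔ nonzeroEigen T = ⊤) {v : V}
    (hv : T (T v) = 0) : T v = 0 := by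
  obtain ⟨a, ha, b, hb, rfl⟩ := Submodule.mem_sup.mp (h ▸ Submodule.mem_top : v ∈ _ ⊔ _)
  rw [map_add, LinearMap.mem_ker.mp ha, zero_add] at hv ⊢
  exact eq_zero_of_mem_nonzeroEigen (apply_mem_nonzeroEigen hb) hv

end Diagonalizable

section Euler

variable {ι : Type*} [DecidableEq ι] [AddMonoid ι] (ℬ : ι → Submodule k R) [GradedAlgebra ℬ]
  (wt : ι →+ k)

/-- The linear map multiplying the homogeneous elements of degree `i` by `wt i`. -/
def eulerLinear : R →ₗ[k] R :=
  DirectSum.toModule k ι R (fun i => wt i • (ℬ i).subtype) ∘ₗ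
    (DirectSum.decomposeLinearEquiv ℬ).toLinearMap

omit [CharZero k] in
lemma eulerLinear_of_mem {i : ι} {x : R} (hx : x ∈ ℬ i) : eulerLinear ℬ wt x = wt i • x := by
  simp only [eulerLinear, LinearMap.comp_apply, LinearEquiv.coe_coe,
    DirectSum.decomposeLinearEquiv_apply, DirectSum.decompose_of_mem ℬ hx]
  erw [DirectSum.toModule_lof]
  rfl

/-- The Euler derivation of a graded algebra, with weights `wt`. -/
def euler : Derivation k R R :=
  Derivation.mk' (eulerLinear ℬ wt) fun x y => by
    induction x using DirectSum.Decomposition.inductionOn ℬ with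
    | zero => simp
    | add a b ha hb => simp only [add_mul, map_add, ha, hb, add_smul, smul_add]; abel
    | @homogeneous i a =>
      induction y using DirectSum.Decomposition.inductionOn ℬ with
      | zero => simp
      | add c e hc he => simp only [mul_add, map_add, hc, he, add_smul, smul_add]; abel
      | @homogeneous j b =>
        rw [eulerLinear_of_mem ℬ wt (SetLike.mul_mem_graded a.2 b.2),
          eulerLinear_of_mem ℬ wt a.2, eulerLinear_of_mem ℬ wt b.2, map_add, add_smul, smul_eq_mul,
          smul_eq_mul, mul_smul_comm, mul_smul_comm, mul_comm (b : R), add_comm]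

omit [CharZero k] in
lemma euler_of_mem {i : ι} {x : R} (hx : x ∈ ℬ i) : euler ℬ wt x = wt i • x :=
  eulerLinear_of_mem ℬ wt hx

lemma lieD_smul_of_mem {X : Derivation k R R} {h : R} {w : Forms k R} {a b : k}
    (hh : X h = a • h) (hw : lieD X w = b • w) : lieD X (h • w) = (a + b) • h • w := by
  rw [lieD_smul, hw, hh, smul_assoc, add_smul, smul_comm h b, add_comm]

lemma lieD_dOne_mul_of_mem {X : Derivation k R R} {h : R} {w : Forms k R} {a b : k}
    (hh : X h = a • h) (hw : lieD X w = b • w) :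
    lieD X (dOne k h * w) = (a + b) • (dOne k h * w) := by
  rw [lieD_dOne_mul, hw, hh, dOne_smul, add_smul, mul_smul_comm, smul_mul_assoc, add_comm]

/-- Forms are sums of eigenvectors of the Lie derivative along an Euler derivation. -/
lemma iSup_eigenspace_lieD_euler :
    ⨆ i, Module.End.eigenspace (lieD (euler ℬ wt)) (wt i) = ⊤ := by
  set X := euler ℬ wt
  refine (Submodule.eq_top_iff' ).mpr fun w => ?_
  induction w using forms_induction with
  | one =>
    refine Submodule.mem_iSup_of_mem 0 ?_
    rw [Module.End.mem_eigenspace_iff, lieD_one, map_zero, zero_smul]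
  | add v w hv hw => exact add_mem hv hw
  | smul h w hw =>
    induction hw using Submodule.iSup_induction' with
    | zero => rw [smul_zero]; exact zero_mem _
    | add v w _ _ hv hw => rw [smul_add]; exact add_mem hv hw
    | mem j w hw =>
      induction h using DirectSum.Decomposition.inductionOn ℬ with
      | zero => rw [zero_smul]; exact zero_mem _
      | add a b ha hb => rw [add_smul]; exact add_mem ha hb
      | @homogeneous i h =>
        refine Submodule.mem_iSup_of_mem (i + j) ?_
        rw [Module.End.mem_eigenspace_iff] at hw ⊢
        rw [map_add]
        exact lieD_smul_of_mem (euler_of_mem ℬ wt h.2) hw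
  | dOne_mul h w hw =>
    induction hw using Submodule.iSup_induction' with
    | zero => rw [mul_zero]; exact zero_mem _
    | add v w _ _ hv hw => rw [mul_add]; exact add_mem hv hw
    | mem j w hw =>
      induction h using DirectSum.Decomposition.inductionOn ℬ with
      | zero => simp [dOne]
      | add a b ha hb => rw [dOne_add, add_mul]; exact add_mem ha hb
      | @homogeneous i h =>
        refine Submodule.mem_iSup_of_mem (i + j) ?_
        rw [Module.End.mem_eigenspace_iff] at hw ⊢
        rw [map_add]
        exact lieD_dOne_mul_of_mem (euler_of_mem ℬ wt h.2) hw

lemma ker_sup_nonzeroEigen_lieD_euler :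
    LinearMap.ker (lieD (euler ℬ wt)) ⊔ nonzeroEigen (lieD (euler ℬ wt)) = ⊤ := by
  rw [eq_top_iff, ← iSup_eigenspace_lieD_euler ℬ wt]
  refine iSup_le fun i => ?_
  by_cases h : wt i = 0
  · rw [h, Module.End.eigenspace_zero]; exact le_sup_left
  · exact le_sup_of_le_right (le_iSup₂_of_le (wt i) h le_rfl)

end Euler

section Connected

variable (𝒜 : ℕ → Submodule k R) [GradedAlgebra 𝒜] (h𝒜 : 𝒜 0 = 1)

/-- The Euler derivation of an `ℕ`-graded algebra. -/
abbrev natEuler : Derivation k R R := euler 𝒜 (Nat.castAddMonoidHom k)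

include h𝒜

omit [CharZero k] [GradedAlgebra 𝒜] in
lemma dOne_of_mem_zero {h : R} (hh : h ∈ 𝒜 0) : dOne k h = 0 := by
  rw [h𝒜] at hh
  obtain ⟨c, rfl⟩ := Submodule.mem_one.mp hh
  simp [dOne]

lemma span_one_sup_nonzeroEigen :
    Submodule.span k {(1 : Forms k R)} ⊔ nonzeroEigen (lieD (natEuler 𝒜)) = ⊤ := by
  set X := natEuler 𝒜
  suffices key : Submodule.span k {(1 : Forms k R)} ⊔
      ⨆ n : ℕ, Module.End.eigenspace (lieD X) ((n + 1 : ℕ) : k) = ⊤ by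
    rw [eq_top_iff, ← key]
    refine sup_le_sup_left (iSup_le fun n => ?_) _
    exact le_iSup₂_of_le ((n + 1 : ℕ) : k) (Nat.cast_ne_zero.mpr n.succ_ne_zero) le_rfl
  have hX : ∀ {i} {h : R}, h ∈ 𝒜 i → X h = (i : k) • h := fun hh => euler_of_mem 𝒜 _ hh
  have hmem : ∀ {n : ℕ} {w : Forms k R}, lieD X w = ((n + 1 : ℕ) : k) • w →
      w ∈ Submodule.span k {(1 : Forms k R)} ⊔
        ⨆ n : ℕ, Module.End.eigenspace (lieD X) ((n + 1 : ℕ) : k) := fun {n} w hw =>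
    Submodule.mem_sup_right (Submodule.mem_iSup_of_mem n (Module.End.mem_eigenspace_iff.mpr hw))
  refine Submodule.eq_top_iff'.mpr fun w => ?_
  induction w using forms_induction with
  | one => exact Submodule.mem_sup_left (Submodule.mem_span_singleton_self _)
  | add v w hv hw => exact add_mem hv hw
  | smul h w hw =>
    induction h using DirectSum.Decomposition.inductionOn 𝒜 with
    | zero => rw [zero_smul]; exact zero_mem _
    | add a b ha hb => rw [add_smul]; exact add_mem ha hb
    | @homogeneous i h =>
      obtain ⟨h, hh⟩ := h
      rcases i with _ | i
      · rw [h𝒜] at hh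
        obtain ⟨c, rfl⟩ := Submodule.mem_one.mp hh
        rw [algebraMap_smul]
        exact Submodule.smul_mem _ _ hw
      obtain ⟨a, ha, b, hb, rfl⟩ := Submodule.mem_sup.mp hw
      obtain ⟨c, rfl⟩ := Submodule.mem_span_singleton.mp ha
      rw [smul_add, smul_comm]
      refine add_mem (Submodule.smul_mem _ _ (hmem (n := i) ?_)) ?_
      · simpa using lieD_smul_of_mem (hX hh) (b := 0) (w := 1) (by simp)
      · clear hw
        induction hb using Submodule.iSup_induction' with
        | zero => rw [smul_zero]; exact zero_mem _
        | add v w _ _ hv hw =>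
          rw [smul_add]
          exact add_mem hv hw
        | mem j w hw =>
          refine hmem (n := i + 1 + j) ?_
          rw [lieD_smul_of_mem (hX hh) (Module.End.mem_eigenspace_iff.mp hw), ← Nat.cast_add,
            add_assoc (i + 1)]
  | dOne_mul h w hw =>
    induction h using DirectSum.Decomposition.inductionOn 𝒜 with
    | zero => simp [dOne]
    | add a b ha hb => rw [dOne_add, add_mul]; exact add_mem ha hb
    | @homogeneous i h =>
      obtain ⟨h, hh⟩ := h
      rcases i with _ | i
      · rw [dOne_of_mem_zero 𝒜 h𝒜 hh, zero_mul]; exact zero_mem _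
      obtain ⟨a, ha, b, hb, rfl⟩ := Submodule.mem_sup.mp hw
      obtain ⟨c, rfl⟩ := Submodule.mem_span_singleton.mp ha
      rw [mul_add, mul_smul_comm]
      refine add_mem (Submodule.smul_mem _ _ (hmem (n := i) ?_)) ?_
      · simpa using lieD_dOne_mul_of_mem (hX hh) (b := 0) (w := 1) (by simp)
      · clear hw
        induction hb using Submodule.iSup_induction' with
        | zero => rw [mul_zero]; exact zero_mem _
        | add v w _ _ hv hw =>
          rw [mul_add]
          exact add_mem hv hw
        | mem j w hw =>
          refine hmem (n := i + 1 + j) ?_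
          rw [lieD_dOne_mul_of_mem (hX hh) (Module.End.mem_eigenspace_iff.mp hw), ← Nat.cast_add,
            add_assoc (i + 1)]

/-- Poincaré lemma: over a connected graded algebra, closed forms are exact up to constants. -/
lemma exists_eq_d_of_closed {w : Forms k R} (hw : d k R w = 0) :
    ∃ (c : k) (v : Forms k R), w = c • 1 + d k R v := by
  have htop := span_one_sup_nonzeroEigen 𝒜 h𝒜
  obtain ⟨a, ha, b, hb, rfl⟩ := Submodule.mem_sup.mp (htop ▸ Submodule.mem_top : w ∈ _ ⊔ _)
  obtain ⟨c, rfl⟩ := Submodule.mem_span_singleton.mp ha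
  rw [map_add, map_smul, d_one, smul_zero, zero_add] at hw
  obtain ⟨v, rfl⟩ := nonzeroEigen_le_range hb
  refine ⟨c, contract (natEuler 𝒜) v, ?_⟩
  suffices hv : d k R v = 0 by rw [lieD_apply, hv, map_zero, add_zero]
  obtain ⟨a', ha', b', hb', hab⟩ :=
    Submodule.mem_sup.mp (htop ▸ Submodule.mem_top : d k R v ∈ _ ⊔ _)
  obtain ⟨c', rfl⟩ := Submodule.mem_span_singleton.mp ha'
  rw [← lieD_d, ← hab, map_add, map_smul, lieD_one, smul_zero, zero_add] at hw
  rw [eq_zero_of_mem_nonzeroEigen hb' hw, add_zero] at hab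
  have h0 := algebraMapInv_d v
  rw [← hab, ← algebraMap_smul R c', map_smul, map_one, smul_eq_mul, mul_one] at h0
  rw [← hab, ← algebraMap_smul R c', h0, zero_smul]

end Connected

section Resolution

variable {ι : Type*} {s : Finset ι} {a b : ι → R} {l : k}

variable (k s a b l) in
/-- The connection form of a family with `∑ aⱼ bⱼ = 1`. -/
def connForm : Forms k R := l⁻¹ • ∑ j ∈ s, a j • dOne k (b j)

variable (k s a b l) in
/-- The curvature form of a family with `∑ aⱼ bⱼ = 1`. -/
def curvForm : Forms k R := l⁻¹ • ∑ j ∈ s, dOne k (a j) * dOne k (b j)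

omit [CharZero k] in
lemma connForm_mul (w : Forms k R) :
    connForm k s a b l * w = l⁻¹ • ∑ j ∈ s, a j • (dOne k (b j) * w) := by
  simp [connForm, Finset.sum_mul]

omit [CharZero k] in
lemma curvForm_mul (w : Forms k R) :
    curvForm k s a b l * w = l⁻¹ • ∑ j ∈ s, dOne k (a j) * (dOne k (b j) * w) := by
  simp [curvForm, Finset.sum_mul, mul_assoc]

lemma d_connForm_mul (w : Forms k R) :
    d k R (connForm k s a b l * w) = curvForm k s a b l * w - connForm k s a b l * d k R w := by
  simp only [connForm_mul, curvForm_mul, map_smul, map_sum, d_smul, d_dOne_mul, smul_neg,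
    Finset.sum_add_distrib, Finset.sum_neg_distrib, smul_add]
  abel

lemma d_curvForm_mul (w : Forms k R) :
    d k R (curvForm k s a b l * w) = curvForm k s a b l * d k R w := by
  simp only [curvForm_mul, map_smul, map_sum, d_dOne_mul, mul_neg, neg_neg]

variable {X}

omit [CharZero k] in
lemma contract_connForm_mul (hl : l ≠ 0) (hb : ∀ j ∈ s, X (b j) = l • b j)
    (hab : ∑ j ∈ s, a j * b j = 1) (w : Forms k R) :
    contract X (connForm k s a b l * w) = w - connForm k s a b l * contract X w := by
  have h : ∀ j ∈ s, contract X (a j • (dOne k (b j) * w)) =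
      l • (a j * b j) • w - a j • (dOne k (b j) * contract X w) := fun j hj => by
    rw [map_smul, contract_dOne_mul, hb j hj, smul_sub, smul_assoc, smul_comm (a j) l, mul_smul]
  rw [connForm_mul, connForm_mul, ← algebraMap_smul R l⁻¹, map_smul, algebraMap_smul, map_sum,
    Finset.sum_congr rfl h, Finset.sum_sub_distrib, ← Finset.smul_sum, ← Finset.sum_smul, hab,
    one_smul, smul_sub, inv_smul_smul₀ hl]

omit [CharZero k] in
lemma contract_curvForm_mul (ha : ∀ j ∈ s, X (a j) = -l • a j)
    (hb : ∀ j ∈ s, X (b j) = l • b j) (hab : ∑ j ∈ s, a j * b j = 1) (w : Forms k R) :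
    contract X (curvForm k s a b l * w) = curvForm k s a b l * contract X w := by
  have h : ∀ j ∈ s, contract X (dOne k (a j) * (dOne k (b j) * w)) =
      -(l • (dOne k (a j * b j) * w)) + dOne k (a j) * (dOne k (b j) * contract X w) :=
    fun j hj => by
      rw [contract_dOne_mul, contract_dOne_mul, hb j hj, ha j hj, dOne_mul]
      simp only [neg_smul, smul_assoc, mul_sub, add_mul, smul_add, mul_smul_comm, smul_mul_assoc]
      abel
  have h1 : ∑ j ∈ s, dOne k (a j * b j) = 0 := by
    have := congrArg (dOne k) hab
    simpa [dOne, map_sum] using this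
  rw [curvForm_mul, curvForm_mul, ← algebraMap_smul R l⁻¹, map_smul, algebraMap_smul, map_sum,
    Finset.sum_congr rfl h, Finset.sum_add_distrib, Finset.sum_neg_distrib, ← Finset.smul_sum,
    ← Finset.sum_mul, h1, zero_mul, smul_zero, neg_zero, zero_add]

lemma lieD_connForm_mul (hl : l ≠ 0) (ha : ∀ j ∈ s, X (a j) = -l • a j)
    (hb : ∀ j ∈ s, X (b j) = l • b j) (hab : ∑ j ∈ s, a j * b j = 1) (w : Forms k R) :
    lieD X (connForm k s a b l * w) = connForm k s a b l * lieD X w := by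
  simp only [lieD_apply, contract_connForm_mul hl hb hab, d_connForm_mul, map_sub,
    contract_curvForm_mul ha hb hab, mul_add]
  abel

omit [CharZero k] in
lemma isNilpotent_curvForm : IsNilpotent (curvForm k s a b l) := by
  have hswap : ∀ g h : R, dOne k g * dOne k h = -(dOne k h * dOne k g) := fun g h =>
    eq_neg_of_add_eq_zero_left (dOne_mul_dOne_add k g h)
  have hcomm : ∀ f g h : R, dOne k f * (dOne k g * dOne k h) = dOne k g * dOne k h * dOne k f := by
    intro f g h
    rw [← mul_assoc, hswap f g, neg_mul, mul_assoc, hswap f h, mul_neg, neg_neg, mul_assoc]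
  refine IsNilpotent.smul (Commute.isNilpotent_sum (fun j _ => ⟨2, ?_⟩) fun i j _ _ => ?_) _
  · rw [sq, mul_assoc, hcomm, mul_assoc, dOne_mul_self, mul_zero, mul_zero]
  · rw [Commute, SemiconjBy, mul_assoc, hcomm (b i), ← mul_assoc, hcomm (a i), mul_assoc]

end Resolution

section Connected

variable {𝒜 : ℕ → Submodule k R} [GradedAlgebra 𝒜]
  {ι : Type*} [DecidableEq ι] [AddMonoid ι] {ℬ : ι → Submodule k R} [GradedAlgebra ℬ]
  {wt : ι →+ k}

/-- A closed form killed by the Lie derivative along an Euler field is, up to a constant, the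
derivative of a form killed by the Lie derivative. -/
lemma exists_invariant_eq_d_of_closed (h𝒜 : 𝒜 0 = 1) {w : Forms k R} (hw : d k R w = 0)
    (hX : lieD (euler ℬ wt) w = 0) :
    ∃ (c : k) (v : Forms k R), w = c • 1 + d k R v ∧ lieD (euler ℬ wt) v = 0 := by
  have htop := ker_sup_nonzeroEigen_lieD_euler ℬ wt
  obtain ⟨c, v, rfl⟩ := exists_eq_d_of_closed 𝒜 h𝒜 hw
  obtain ⟨v₀, hv₀, v', hv', rfl⟩ := Submodule.mem_sup.mp (htop ▸ Submodule.mem_top : v ∈ _ ⊔ _)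
  obtain ⟨u, rfl⟩ := nonzeroEigen_le_range hv'
  refine ⟨c, v₀, ?_, hv₀⟩
  rw [map_add, map_add, map_add, map_smul, lieD_one, smul_zero, zero_add, lieD_d,
    LinearMap.mem_ker.mp hv₀, map_zero, zero_add, ← lieD_d] at hX
  rw [map_add, ← lieD_d, apply_eq_zero_of_sq htop hX, add_zero]

/-- In a connected graded algebra, a second grading has no unit expressible through
homogeneous elements of nonzero weight. -/
theorem sum_mul_ne_one [Nontrivial R] (h𝒜 : 𝒜 0 = 1) {σ : Type*} {s : Finset σ} {a b : σ → R}
    {l : k} (hl : l ≠ 0) (ha : ∀ j ∈ s, euler ℬ wt (a j) = -l • a j)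
    (hb : ∀ j ∈ s, euler ℬ wt (b j) = l • b j) : ∑ j ∈ s, a j * b j ≠ 1 := by
  intro hab
  set X := euler ℬ wt
  set c := curvForm k s a b l
  have hdc : ∀ n, d k R (c ^ n) = 0 := fun n => by
    induction n with
    | zero => simp
    | succ n ih => rw [pow_succ', d_curvForm_mul, ih, mul_zero]
  have hιc : ∀ n, contract X (c ^ n) = 0 := fun n => by
    induction n with
    | zero => simp
    | succ n ih => rw [pow_succ', contract_curvForm_mul ha hb hab, ih, mul_zero]
  have hLc : ∀ n, lieD X (c ^ n) = 0 := fun n => by rw [lieD_apply, hdc, hιc]; simp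
  obtain ⟨N, hN⟩ : IsNilpotent c := isNilpotent_curvForm
  have key : ∀ m n, m + n = N → ∃ v, c ^ n = d k R v ∧ contract X v = 0 ∧ lieD X v = 0 := by
    intro m
    induction m with
    | zero => rintro n h; exact ⟨0, by rw [map_zero, ← hN, ← h, zero_add], by simp, by simp⟩
    | succ m ih =>
      intro n h
      obtain ⟨v, hv, hιv, hLv⟩ := ih (n + 1) (by omega)
      obtain ⟨e, u, hu, hLu⟩ := exists_invariant_eq_d_of_closed (ℬ := ℬ) (wt := wt) h𝒜
        (w := connForm k s a b l * c ^ n - v)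
        (by rw [map_sub, d_connForm_mul, hdc, mul_zero, sub_zero, ← pow_succ', hv, sub_self])
        (by rw [map_sub, lieD_connForm_mul hl ha hb hab, hLc, hLv, mul_zero, sub_zero])
      refine ⟨-contract X u, ?_, by rw [map_neg, contract_contract, neg_zero],
        by rw [map_neg, lieD_contract, hLu, map_zero, neg_zero]⟩
      have h1 := congrArg (contract X) hu
      rw [map_sub, hιv, sub_zero, contract_connForm_mul hl hb hab, hιc, mul_zero, sub_zero, map_add,
        ← algebraMap_smul R e, map_smul, contract_one, smul_zero, zero_add] at h1
      rw [h1, map_neg, eq_neg_iff_add_eq_zero, add_comm, ← lieD_apply, hLu]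
  obtain ⟨v, hv, -⟩ := key N 0 rfl
  exact d_ne_one v (by rw [← hv, pow_zero])

/-- Homogeneous elements of nonzero degree for an additive grading of a connected graded algebra
generate a proper ideal. -/
theorem span_homogeneous_ne_top [Nontrivial R] (h𝒜 : 𝒜 0 = 1) (ℬ : k → Submodule k R)
    [DecidableEq k] [GradedAlgebra ℬ] {l : k} (hl : l ≠ 0) : Ideal.span (ℬ l : Set R) ≠ ⊤ := by
  intro h
  have h1 : (1 : R) ∈ Submodule.span R (ℬ l : Set R) := (Ideal.eq_top_iff_one _).mp h
  obtain ⟨c, hc⟩ := (Finsupp.mem_span_iff_linearCombination R _ _).mp h1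
  rw [Finsupp.linearCombination_apply, Finsupp.sum] at hc
  have h2 := congrArg (fun x => (DirectSum.decompose ℬ x (0 : k) : R)) hc
  refine sum_mul_ne_one (ℬ := ℬ) (wt := AddMonoidHom.id k) h𝒜 hl (s := c.support)
    (a := fun j => (DirectSum.decompose ℬ (c j) (-l) : R)) (b := fun j => j)
    (fun j _ => euler_of_mem _ _ (SetLike.coe_mem _)) (fun j _ => euler_of_mem _ _ j.2) ?_
  simp only [DirectSum.decompose_sum, smul_eq_mul] at h2
  rw [DirectSum.decompose_of_mem_same ℬ (SetLike.GradedOne.one_mem)] at h2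
  rw [← h2, DFinsupp.finsetSum_apply, AddSubmonoidClass.coe_finsetSum]
  refine Finset.sum_congr rfl fun j _ => ?_
  have := DirectSum.coe_decompose_mul_add_of_right_mem ℬ (i := -l) (a := c j) j.2
  rw [neg_add_cancel] at this
  exact this.symm

end Connected

end DeRham

end

noncomputable section
namespace HopfSlice

open TensorProduct Coalgebra

attribute [local instance] LieRing.ofAssociativeRing

section Slices

variable {k M N : Type*} [Field k] [AddCommGroup M] [Module k M] [AddCommGroup N] [Module k N]

/-- Applying a functional to the right tensor factor. -/
def sliceRight (f : N →ₗ[k] k) : M ⊗[k] N →ₗ[k] M :=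
  (TensorProduct.rid k M).toLinearMap ∘ₗ f.lTensor M

/-- Applying a functional to the left tensor factor. -/
def sliceLeft (f : M →ₗ[k] k) : M ⊗[k] N →ₗ[k] N :=
  (TensorProduct.lid k N).toLinearMap ∘ₗ f.rTensor N

@[simp] lemma sliceRight_tmul (f : N →ₗ[k] k) (x : M) (y : N) :
    sliceRight f (x ⊗ₜ[k] y) = f y • x := by simp [sliceRight]

@[simp] lemma sliceLeft_tmul (f : M →ₗ[k] k) (x : M) (y : N) :
    sliceLeft f (x ⊗ₜ[k] y) = f x • y := by simp [sliceLeft]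

lemma eq_zero_of_sliceRight {t : M ⊗[k] N} (h : ∀ f : N →ₗ[k] k, sliceRight f t = 0) : t = 0 := by
  classical
  let b := Module.Basis.ofVectorSpace k N
  refine (TensorProduct.equivFinsuppOfBasisRight (M := M) b).map_eq_zero_iff.mp ?_
  ext i
  rw [TensorProduct.equivFinsuppOfBasisRight_apply]
  exact h _

lemma eq_zero_of_sliceLeft {t : M ⊗[k] N} (h : ∀ f : M →ₗ[k] k, sliceLeft f t = 0) : t = 0 := by
  classical
  let b := Module.Basis.ofVectorSpace k M
  refine (TensorProduct.equivFinsuppOfBasisLeft (N := N) b).map_eq_zero_iff.mp ?_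
  ext i
  rw [TensorProduct.equivFinsuppOfBasisLeft_apply]
  exact h _

lemma exists_finite_sliceRight_mem (t : M ⊗[k] N) :
    ∃ V : Submodule k M, FiniteDimensional k V ∧ ∀ f : N →ₗ[k] k, sliceRight f t ∈ V := by
  induction t with
  | zero => exact ⟨⊥, inferInstance, by simp⟩
  | tmul x y =>
    refine ⟨k ∙ x, inferInstance, fun f => ?_⟩
    rw [sliceRight_tmul]
    exact Submodule.smul_mem _ _ (Submodule.mem_span_singleton_self x)
  | add s t hs ht =>
    obtain ⟨V, _, hV⟩ := hs
    obtain ⟨W, _, hW⟩ := ht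
    refine ⟨V ⊔ W, inferInstance, fun f => ?_⟩
    rw [map_add]
    exact Submodule.add_mem_sup (hV f) (hW f)

end Slices

variable {k H : Type*} [Field k] [CommRing H] [HopfAlgebra k H]

/-- The operator `x ↦ x₁ f(x₂)`. -/
def rightOp (f : H →ₗ[k] k) : H →ₗ[k] H := sliceRight f ∘ₗ comul

/-- The operator `x ↦ f(x₁) x₂`. -/
def leftOp (f : H →ₗ[k] k) : H →ₗ[k] H := sliceLeft f ∘ₗ comul

lemma rightOp_counit (x : H) : rightOp (counit (R := k)) x = x := by
  simp [rightOp, sliceRight]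

lemma counit_leftOp (f : H →ₗ[k] k) (x : H) : counit (R := k) (leftOp f x) = f x := by
  have h : (counit (R := k) (A := H)) ∘ₗ sliceLeft f = f ∘ₗ sliceRight counit := by
    ext x y; simp [mul_comm]
  refine (LinearMap.congr_fun h (comul x)).trans ?_
  simp [sliceRight]

lemma comul_rightOp (f : H →ₗ[k] k) (x : H) :
    comul (R := k) (rightOp f x) = (rightOp f).lTensor H (comul x) := by
  have h1 : (comul (R := k) (A := H)) ∘ₗ sliceRight f = sliceRight f ∘ₗ comul.rTensor H := by
    ext x y; simp
  have h2 : sliceRight f ∘ₗ (TensorProduct.assoc k H H H).symm.toLinearMap =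
      (sliceRight f).lTensor H := by
    ext x y z; simp
  have h3 : (rightOp f).lTensor H (comul x) = (sliceRight f).lTensor H (comul.lTensor H (comul x)) := by
    rw [rightOp, LinearMap.lTensor_comp, LinearMap.comp_apply]
  rw [h3, ← h2, LinearMap.comp_apply, LinearEquiv.coe_coe, coassoc_symm_apply]
  exact LinearMap.congr_fun h1 (comul x)

lemma rightOp_rightOp (f g : H →ₗ[k] k) (x : H) :
    rightOp f (rightOp g x) = rightOp (f ∘ₗ rightOp g) x := by
  change sliceRight f (comul (rightOp g x)) = sliceRight (f ∘ₗ rightOp g) (comul x)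
  rw [comul_rightOp, sliceRight, sliceRight, LinearMap.lTensor_comp]
  rfl

variable (k H) in
/-- The Lie algebra of left-invariant derivations. -/
def leftInvariant : LieSubalgebra k (Module.End k H) where
  carrier := {X | (∀ a b, X (a * b) = a * X b + X a * b) ∧
    ∀ x, comul (R := k) (X x) = LinearMap.lTensor H X (comul x)}
  zero_mem' := by simp
  add_mem' {X Y} hX hY := by
    refine ⟨fun a b => ?_, fun x => ?_⟩
    · simp only [LinearMap.add_apply, hX.1, hY.1]; ring
    · simp [hX.2, hY.2, LinearMap.lTensor_add]
  smul_mem' c X hX := by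
    refine ⟨fun a b => ?_, fun x => ?_⟩
    · simp only [LinearMap.smul_apply, hX.1, smul_add, mul_smul_comm, smul_mul_assoc]
    · simp [hX.2, LinearMap.lTensor_smul]
  lie_mem' {X Y} hX hY := by
    refine ⟨fun a b => ?_, fun x => ?_⟩
    · simp only [LieRing.of_associative_ring_bracket, LinearMap.sub_apply, Module.End.mul_apply,
        hX.1, hY.1, map_add]
      ring
    · have h : ∀ Z W : Module.End k H, LinearMap.lTensor H (Z * W) =
          LinearMap.lTensor H Z ∘ₗ LinearMap.lTensor H W := fun Z W => LinearMap.lTensor_comp _ _ _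
      simp [LieRing.of_associative_ring_bracket, hX.2, hY.2, LinearMap.lTensor_sub, h]

lemma rightOp_mem_leftInvariant {D : H →ₗ[k] k}
    (hD : ∀ a b, D (a * b) = counit (R := k) a * D b + D a * counit (R := k) b) :
    rightOp D ∈ leftInvariant k H := by
  refine ⟨fun a b => ?_, comul_rightOp D⟩
  have key : ∀ s t : H ⊗[k] H, sliceRight D (s * t) =
      sliceRight (counit (R := k)) s * sliceRight D t +
        sliceRight D s * sliceRight (counit (R := k)) t := fun s t => by
    induction s with
    | zero => simp
    | add s s' hs hs' => simp only [add_mul, map_add, hs, hs']; ring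
    | tmul x y =>
      induction t with
      | zero => simp
      | add t t' ht ht' => simp only [mul_add, map_add, ht, ht']; ring
      | tmul z w =>
        simp [hD, add_smul, smul_smul, mul_comm]
  have h := key (comul a) (comul b)
  rw [← Bialgebra.comul_mul] at h
  change rightOp D (a * b) = rightOp (counit (R := k)) a * rightOp D b +
    rightOp D a * rightOp (counit (R := k)) b at h
  rwa [rightOp_counit, rightOp_counit] at h

lemma eq_rightOp {X : Module.End k H} (hX : X ∈ leftInvariant k H) (x : H) :
    X x = rightOp (counit (R := k) ∘ₗ X) x := by
  rw [← rightOp_counit (k := k) (X x), rightOp, LinearMap.comp_apply, hX.2, rightOp, sliceRight,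
    sliceRight, LinearMap.lTensor_comp]
  rfl

lemma apply_leftOp {X : Module.End k H} (hX : X ∈ leftInvariant k H) (f : H →ₗ[k] k) (x : H) :
    X (leftOp f x) = leftOp f (X x) := by
  have h : X ∘ₗ sliceLeft f = sliceLeft f ∘ₗ LinearMap.lTensor H X := by ext; simp
  rw [leftOp, LinearMap.comp_apply, LinearMap.comp_apply, hX.2]
  exact LinearMap.congr_fun h (comul x)

variable (k) in
/-- The finite-dimensional space of right translates of `x`. -/
def translates (x : H) : LieSubmodule k (leftInvariant k H) H where
  carrier := {y | ∃ f : H →ₗ[k] k, rightOp f x = y}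
  zero_mem' := ⟨0, by simp [rightOp, sliceRight]⟩
  add_mem' := by
    rintro _ _ ⟨f, rfl⟩ ⟨g, rfl⟩
    exact ⟨f + g, by simp [rightOp, sliceRight, LinearMap.lTensor_add]⟩
  smul_mem' := by
    rintro c _ ⟨f, rfl⟩
    exact ⟨c • f, by simp [rightOp, sliceRight, LinearMap.lTensor_smul]⟩
  lie_mem := by
    rintro X _ ⟨f, rfl⟩
    exact ⟨_, (rightOp_rightOp _ f x).symm.trans (eq_rightOp X.2 _).symm⟩

lemma self_mem_translates (x : H) : x ∈ translates k x := ⟨_, rightOp_counit x⟩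

instance (x : H) : FiniteDimensional k (translates k x) := by
  obtain ⟨V, _, hV⟩ := exists_finite_sliceRight_mem (comul (R := k) x)
  refine Submodule.finiteDimensional_of_le (S₁ := (translates k x).toSubmodule) (S₂ := V) ?_
  rintro _ ⟨f, rfl⟩
  exact hV f

lemma comul_antipode_deriv_mul {E : Derivation k H H} (a b : H) :
    LinearMap.mul' k H (TensorProduct.map (HopfAlgebra.antipode k) E (comul (R := k) (a * b))) =
      counit (R := k) a •
        LinearMap.mul' k H (TensorProduct.map (HopfAlgebra.antipode k) E (comul (R := k) b)) +
      counit (R := k) b •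
        LinearMap.mul' k H (TensorProduct.map (HopfAlgebra.antipode k) E (comul (R := k) a)) := by
  have key : ∀ s t : H ⊗[k] H,
      LinearMap.mul' k H (TensorProduct.map (HopfAlgebra.antipode k) (E : H →ₗ[k] H) (s * t)) =
      LinearMap.mul' k H ((HopfAlgebra.antipode k).rTensor H s) *
        LinearMap.mul' k H (TensorProduct.map (HopfAlgebra.antipode k) (E : H →ₗ[k] H) t) +
      LinearMap.mul' k H ((HopfAlgebra.antipode k).rTensor H t) *
        LinearMap.mul' k H (TensorProduct.map (HopfAlgebra.antipode k) (E : H →ₗ[k] H) s) := by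
    intro s t
    induction s with
    | zero => simp
    | add s s' hs hs' => simp only [add_mul, map_add, hs, hs']; ring
    | tmul x y =>
      induction t with
      | zero => simp
      | add t t' ht ht' => simp only [mul_add, map_add, ht, ht']; ring
      | tmul z w =>
        simp [HopfAlgebra.antipode_mul_distrib]; ring
  have h := key (comul a) (comul b)
  rw [← Bialgebra.comul_mul, HopfAlgebra.mul_antipode_rTensor_comul_apply,
    HopfAlgebra.mul_antipode_rTensor_comul_apply, ← Algebra.smul_def, ← Algebra.smul_def] at h
  exact h

open WithConv in
/-- An element killed by all left-invariant derivations is killed by all derivations. -/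
lemma derivation_eq_zero_of_leftInvariant (E : Derivation k H H) {x : H}
    (hx : ∀ X ∈ leftInvariant k H, X x = 0) : E x = 0 := by
  set e : H →ₗ[k] H := ofConv (toConv (HopfAlgebra.antipode k) * toConv (E : H →ₗ[k] H)) with he
  have h0 : e.lTensor H (comul x) = 0 := eq_zero_of_sliceRight fun f => by
    have hX := hx (rightOp (f ∘ₗ e)) (rightOp_mem_leftInvariant fun a b => by
      simp only [LinearMap.comp_apply]
      refine (congrArg f (comul_antipode_deriv_mul (E := E) a b)).trans ?_
      rw [map_add, map_smul, map_smul, smul_eq_mul, smul_eq_mul, mul_comm (counit b)]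
      rfl)
    rw [rightOp, sliceRight, LinearMap.lTensor_comp] at hX
    exact hX
  have h1 : toConv LinearMap.id * (toConv (HopfAlgebra.antipode k) * toConv (E : H →ₗ[k] H)) =
      toConv (E : H →ₗ[k] H) := by
    rw [← mul_assoc, LinearMap.id_mul_antipode, one_mul]
  have h2 := LinearMap.congr_fun (congrArg ofConv h1) x
  refine h2.symm.trans ?_
  change LinearMap.mul' k H (e.lTensor H (comul x)) = 0
  rw [h0, map_zero]


section Connected

variable [CharZero k] {𝒜 : ℕ → Submodule k H} [GradedAlgebra 𝒜]

omit [HopfAlgebra k H] in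
lemma mem_zero_of_natEuler_eq_zero [Algebra k H] {ℬ : ℕ → Submodule k H} [GradedAlgebra ℬ] {x : H}
    (hx : DeRham.natEuler ℬ x = 0) : x ∈ ℬ 0 := by
  have key : ∀ (n : ℕ) (y : H), (DirectSum.decompose ℬ (DeRham.natEuler ℬ y) n : H) =
      (n : k) • (DirectSum.decompose ℬ y n : H) := fun n y => by
    induction y using DirectSum.Decomposition.inductionOn ℬ with
    | zero => simp
    | add a b ha hb => simp [DirectSum.decompose_add, ha, hb]
    | @homogeneous i a =>
      rw [DeRham.euler_of_mem ℬ _ a.2]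
      by_cases h : i = n
      · subst h
        rw [DirectSum.decompose_of_mem_same ℬ (Submodule.smul_mem _ _ a.2),
          DirectSum.decompose_of_mem_same ℬ a.2, Nat.coe_castAddMonoidHom]
      · rw [DirectSum.decompose_of_mem_ne ℬ (Submodule.smul_mem _ _ a.2) h,
          DirectSum.decompose_of_mem_ne ℬ a.2 h, smul_zero]
  have h0 : ∀ n ≠ 0, (DirectSum.decompose ℬ x n : H) = 0 := fun n hn => by
    have h := key n x
    rw [hx, DirectSum.decompose_zero, DirectSum.zero_apply, ZeroMemClass.coe_zero] at h
    exact (smul_eq_zero_iff_right (Nat.cast_ne_zero.mpr hn)).mp h.symm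
  classical
  rw [← DirectSum.sum_support_decompose ℬ x]
  refine sum_mem fun n _ => ?_
  rcases eq_or_ne n 0 with rfl | hn
  · exact SetLike.coe_mem _
  · rw [h0 n hn]; exact zero_mem _

/-- In a connected graded Hopf algebra, the constants are the elements killed by all
left-invariant derivations. -/
lemma eq_algebraMap_of_leftInvariant (h𝒜 : 𝒜 0 = 1) {x : H}
    (hx : ∀ X ∈ leftInvariant k H, X x = 0) : x = algebraMap k H (counit (R := k) x) := by
  have h := mem_zero_of_natEuler_eq_zero
    (derivation_eq_zero_of_leftInvariant (DeRham.natEuler 𝒜) hx)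
  rw [h𝒜] at h
  obtain ⟨c, rfl⟩ := Submodule.mem_one.mp h
  simp

end Connected

section Weights

lemma apply_one {X : Module.End k H} (hX : X ∈ leftInvariant k H) : X 1 = 0 := by
  simpa using hX.1 1 1

/-- Multiplication is equivariant under left-invariant derivations. -/
def mulLie : H ⊗[k] H →ₗ⁅k, leftInvariant k H⁆ H where
  toLinearMap := LinearMap.mul' k H
  map_lie' {X} t := by
    induction t with
    | zero => simp
    | add s t hs ht =>
      simp only [lie_add, map_add, AddHom.toFun_eq_coe, LinearMap.coe_toAddHom] at hs ht ⊢
      rw [hs, ht]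
    | tmul a b =>
      exact (add_comm _ _).trans (X.2.1 a b).symm

lemma mul_mem_maxGenEigenspace (X : leftInvariant k H) {μ ν : k} {a b : H}
    (ha : a ∈ (X : Module.End k H).maxGenEigenspace μ)
    (hb : b ∈ (X : Module.End k H).maxGenEigenspace ν) :
    a * b ∈ (X : Module.End k H).maxGenEigenspace (μ + ν) :=
  LieModule.weight_vector_multiplication H H H (mulLie (k := k)) (R := k) μ ν X
    ⟨⟨a, ha⟩ ⊗ₜ ⟨b, hb⟩, by simp [mulLie, TensorProduct.mapIncl]⟩

lemma one_mem_maxGenEigenspace (X : leftInvariant k H) :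
    1 ∈ (X : Module.End k H).maxGenEigenspace 0 :=
  ((X : Module.End k H).mem_maxGenEigenspace 0 1).mpr ⟨1, by simp [apply_one X.2]⟩

lemma iSup_maxGenEigenspace_eq_top [IsAlgClosed k] (X : leftInvariant k H) :
    ⨆ μ, (X : Module.End k H).maxGenEigenspace μ = ⊤ := by
  refine Submodule.eq_top_iff'.mpr fun x => ?_
  let V : Submodule k H := translates k x
  have hV : Set.MapsTo (X : Module.End k H) V V := fun y hy => (translates k x).lie_mem (x := X) hy
  have : FiniteDimensional k V := inferInstanceAs (FiniteDimensional k (translates k x))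
  let Y : Module.End k V := LinearMap.restrict (X : Module.End k H) hV
  have hx : (⟨x, self_mem_translates x⟩ : V) ∈ ⨆ μ, Y.maxGenEigenspace μ :=
    Y.iSup_maxGenEigenspace_eq_top ▸ Submodule.mem_top
  have h2 := Submodule.mem_map_of_mem (f := V.subtype) hx
  rw [Submodule.map_iSup] at h2
  have hle : ∀ μ, (Y.maxGenEigenspace μ).map V.subtype ≤
      (X : Module.End k H).maxGenEigenspace μ := fun μ => by
    rw [Submodule.map_le_iff_le_comap]
    exact (Module.End.genEigenspace_restrict (X : Module.End k H) V ⊤ μ hV).le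
  exact (iSup_mono hle : _ ≤ _) h2

variable [DecidableEq k] [IsAlgClosed k]

/-- The grading of a commutative Hopf algebra by generalized eigenspaces of a left-invariant
derivation. -/
@[reducible] def weightGrading (X : leftInvariant k H) :
    GradedAlgebra (X : Module.End k H).maxGenEigenspace :=
  { (DirectSum.isInternal_submodule_of_iSupIndep_of_iSup_eq_top
      (X : Module.End k H).independent_maxGenEigenspace
      (iSup_maxGenEigenspace_eq_top X)).chooseDecomposition with
    one_mem := one_mem_maxGenEigenspace X
    mul_mem := fun _ _ _ _ ha hb => mul_mem_maxGenEigenspace X ha hb }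

omit [DecidableEq k] in
/-- Left-invariant derivations of a connected graded commutative Hopf algebra have no nonzero
weights. -/
lemma maxGenEigenspace_eq_bot [CharZero k] {𝒜 : ℕ → Submodule k H} [GradedAlgebra 𝒜]
    (h𝒜 : 𝒜 0 = 1) (X : leftInvariant k H) {l : k} (hl : l ≠ 0) :
    (X : Module.End k H).maxGenEigenspace l = ⊥ := by
  classical
  by_contra hne
  obtain ⟨v, hv, hv0⟩ := (Submodule.ne_bot_iff _).mp hne
  obtain ⟨n, hn⟩ := (Module.End.mem_maxGenEigenspace _ _ _).mp hv
  obtain ⟨f, hf⟩ := Module.Projective.exists_dual_ne_zero k hv0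
  set T : Module.End k H := (X : Module.End k H) - l • 1 with hT
  set w := leftOp f v
  have hcomm : ∀ (m : ℕ) (y : H), (T ^ m) (leftOp f y) = leftOp f ((T ^ m) y) := fun m => by
    induction m with
    | zero => simp
    | succ m ih =>
      intro y
      rw [pow_succ, Module.End.mul_apply, Module.End.mul_apply, ← ih]
      simp [hT, apply_leftOp X.2]
  have hw : (T ^ n) w = 0 := by rw [hcomm, hn, map_zero]
  have hcomul : ∀ (m : ℕ) (y : H), comul (R := k) ((T ^ m) y) =
      LinearMap.lTensor H (T ^ m) (comul y) := fun m => by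
    induction m with
    | zero => simp [Module.End.one_eq_id]
    | succ m ih =>
      intro y
      rw [pow_succ, Module.End.mul_apply, ih, Module.End.mul_eq_comp, LinearMap.lTensor_comp,
        LinearMap.comp_apply]
      congr 1
      simp [hT, X.2.2, LinearMap.lTensor_sub, LinearMap.lTensor_smul, Module.End.one_eq_id]
  have hker : comul (R := k) w ∈
      LinearMap.range (LinearMap.lTensor H (LinearMap.ker (T ^ n)).subtype) :=
    (Module.Flat.lTensor_exact H (LinearMap.exact_subtype_ker_map (T ^ n)) _).mp
      (by rw [← hcomul, hw, map_zero])
  have hmem : ∀ t ∈ LinearMap.range (LinearMap.lTensor H (LinearMap.ker (T ^ n)).subtype),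
      LinearMap.mul' k H ((HopfAlgebra.antipode k).rTensor H t) ∈
        Ideal.span ((X : Module.End k H).maxGenEigenspace l : Set H) := by
    rintro _ ⟨t, rfl⟩
    induction t with
    | zero => simp
    | add s t hs ht => simp only [map_add]; exact add_mem hs ht
    | tmul a b =>
      simp only [LinearMap.lTensor_tmul, LinearMap.rTensor_tmul, LinearMap.mul'_apply]
      exact Ideal.mul_mem_left _ _ (Ideal.subset_span
        ((Module.End.mem_maxGenEigenspace _ _ _).mpr ⟨n, b.2⟩))
  have h1 := hmem _ hker
  rw [HopfAlgebra.mul_antipode_rTensor_comul_apply, counit_leftOp] at h1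
  let _ := weightGrading X
  have := (RingHom.domain_nontrivial (Bialgebra.counitAlgHom k H).toRingHom)
  exact DeRham.span_homogeneous_ne_top h𝒜 (X : Module.End k H).maxGenEigenspace hl
    (Ideal.eq_top_of_isUnit_mem _ h1 ((IsUnit.mk0 _ hf).map (algebraMap k H)))

end Weights


section Filtration

variable [CharZero k] {𝒜 : ℕ → Submodule k H} [GradedAlgebra 𝒜]

/-- Engel's theorem: the upper central series of the left-invariant derivations exhausts the Hopf
algebra. -/
lemma exists_mem_ucs [IsAlgClosed k] (h𝒜 : 𝒜 0 = 1) (x : H) :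
    ∃ n, x ∈ (⊥ : LieSubmodule k (leftInvariant k H) H).ucs n := by
  suffices h : LieModule.IsNilpotent (leftInvariant k H) (translates k x) by
    obtain ⟨n, hn⟩ := (translates k x).isNilpotent_iff_exists_self_le_ucs.mp h
    exact ⟨n, hn (self_mem_translates x)⟩
  refine (LieModule.isNilpotent_iff_forall' (R := k)).mpr fun X => ?_
  refine Module.End.isNilpotent_iff_of_finite.mpr fun y => ?_
  have hy : (y : H) ∈ (X : Module.End k H).maxGenEigenspace 0 := by
    have htop : (y : H) ∈ ⨆ μ, (X : Module.End k H).maxGenEigenspace μ :=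
      iSup_maxGenEigenspace_eq_top X ▸ Submodule.mem_top
    have hle : ⨆ μ, (X : Module.End k H).maxGenEigenspace μ ≤
        (X : Module.End k H).maxGenEigenspace 0 := iSup_le fun μ => by
      rcases eq_or_ne μ 0 with rfl | hμ
      · exact le_rfl
      · rw [maxGenEigenspace_eq_bot h𝒜 X hμ]; exact bot_le
    exact hle htop
  obtain ⟨n, hn⟩ := (Module.End.mem_maxGenEigenspace _ _ _).mp hy
  rw [zero_smul, sub_zero] at hn
  have hpow : ∀ (m : ℕ) (z : translates k x),
      ((LieModule.toEnd k (leftInvariant k H) (translates k x) X ^ m) z : H) =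
        ((X : Module.End k H) ^ m) z := fun m => by
    induction m with
    | zero => simp
    | succ m ih => intro z; rw [pow_succ, pow_succ, Module.End.mul_apply, ih]; rfl
  exact ⟨n, Subtype.ext ((hpow n y).trans hn)⟩

lemma leftOp_eq_algebraMap (h𝒜 : 𝒜 0 = 1) (n : ℕ) {x : H} {f : H →ₗ[k] k}
    (hx : x ∈ (⊥ : LieSubmodule k (leftInvariant k H) H).ucs (n + 1))
    (hf : ∀ y ∈ (⊥ : LieSubmodule k (leftInvariant k H) H).ucs n, f y = 0) :
    leftOp f x = algebraMap k H (f x) := by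
  induction n generalizing x with
  | zero =>
    rw [← counit_leftOp f x]
    refine eq_algebraMap_of_leftInvariant h𝒜 fun X hX => ?_
    rw [LieSubmodule.ucs_succ, LieSubmodule.mem_normalizer] at hx
    have h : X x = 0 := hx ⟨X, hX⟩
    rw [apply_leftOp hX, h, map_zero]
  | succ n ih =>
    rw [← counit_leftOp f x]
    refine eq_algebraMap_of_leftInvariant h𝒜 fun X hX => ?_
    rw [LieSubmodule.ucs_succ, LieSubmodule.mem_normalizer] at hx
    have h := hx ⟨X, hX⟩
    have h0 : f (X x) = 0 := hf _ h
    rw [apply_leftOp hX, ih (x := X x) h fun y hy => hf y ?_, h0, map_zero]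
    rw [LieSubmodule.ucs_succ]
    exact LieSubmodule.le_normalizer _ hy

/-- A connected graded commutative Hopf algebra over an algebraically closed field of
characteristic zero is conilpotent, even if its coproduct does not respect the grading. -/
theorem exists_filtration [IsAlgClosed k] (h𝒜 : 𝒜 0 = 1) :
    ∃ F : ℕ → Submodule k H, F 0 = ⊥ ∧ (∀ n, F n ≤ F (n + 1)) ∧ (∀ x, ∃ n, x ∈ F n) ∧
      ∀ n, ∀ x ∈ F (n + 1),
        comul (R := k) x - x ⊗ₜ[k] 1 ∈ LinearMap.range ((F n).subtype.rTensor H) := by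
  refine ⟨fun n => ((⊥ : LieSubmodule k (leftInvariant k H) H).ucs n).toSubmodule, by simp, fun n => ?_,
    exists_mem_ucs h𝒜, fun n x hx => ?_⟩
  · simp only [LieSubmodule.ucs_succ]
    exact LieSubmodule.le_normalizer _
  set F : Submodule k H := ((⊥ : LieSubmodule k (leftInvariant k H) H).ucs n).toSubmodule
  refine (rTensor_exact H (LinearMap.exact_subtype_mkQ F) F.mkQ_surjective _).mp ?_
  refine eq_zero_of_sliceLeft fun f => ?_
  have h : sliceLeft f ∘ₗ F.mkQ.rTensor H = sliceLeft (N := H) (f ∘ₗ F.mkQ) := by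
    rw [sliceLeft, sliceLeft, LinearMap.rTensor_comp]; rfl
  rw [← LinearMap.comp_apply, h, map_sub, sliceLeft_tmul, ← Algebra.algebraMap_eq_smul_one,
    sub_eq_zero]
  refine leftOp_eq_algebraMap h𝒜 n hx fun y hy => ?_
  rw [LinearMap.comp_apply, Submodule.mkQ_apply, (Submodule.Quotient.mk_eq_zero F).mpr hy, map_zero]

end Filtration

end HopfSlice

end

namespace Birkhoff

open TensorProduct Coalgebra

section Convolution

variable (f g φ : H →ₗ[ℂ] A)

lemma conv_one : conv f g 1 = f 1 * g 1 := by
  simp [conv, Bialgebra.comul_one, Algebra.TensorProduct.one_def]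

lemma conv_sub_left : conv (f - g) φ = conv f φ - conv g φ :=
  congrArg WithConv.ofConv (sub_mul (WithConv.toConv f) (WithConv.toConv g) (WithConv.toConv φ))

lemma conv_sub_right : conv φ (f - g) = conv φ f - conv φ g :=
  congrArg WithConv.ofConv (mul_sub (WithConv.toConv φ) (WithConv.toConv f) (WithConv.toConv g))

lemma conv_counit : conv f (Algebra.linearMap ℂ A ∘ₗ counit) = f :=
  congrArg WithConv.ofConv (mul_one (WithConv.toConv f))

lemma conv_antipode_conv (p : H →ₐ[ℂ] A) :
    conv (p.toLinearMap ∘ₗ HopfAlgebra.antipode ℂ) (conv p.toLinearMap φ) = φ := by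
  have h : WithConv.toConv (p.toLinearMap ∘ₗ HopfAlgebra.antipode ℂ) *
      WithConv.toConv p.toLinearMap = 1 := by
    have h := LinearMap.algHom_comp_convMul_distrib p
      (WithConv.toConv (HopfAlgebra.antipode ℂ (A := H))) (WithConv.toConv LinearMap.id)
    rw [LinearMap.antipode_mul_id] at h
    refine WithConv.ext (Eq.trans (Eq.symm h) ?_)
    ext x
    simp
  have h' := mul_assoc (WithConv.toConv (p.toLinearMap ∘ₗ HopfAlgebra.antipode ℂ))
    (WithConv.toConv p.toLinearMap) (WithConv.toConv φ)
  rw [h, one_mul] at h'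
  exact (congrArg WithConv.ofConv h').symm

end Convolution

section Defect

/-- The multiplicativity defect of a unital linear map sending the augmentation ideal into a
multiplicatively closed subspace takes its values in that subspace. -/
lemma map_mul_sub_mem {S : Submodule ℂ A} (hS : ∀ x y : A, x ∈ S → y ∈ S → x * y ∈ S)
    {f : H →ₗ[ℂ] A} (hf1 : f 1 = 1) (hf : ∀ x, counit (R := ℂ) x = 0 → f x ∈ S) (x y : H) :
    f (x * y) - f x * f y ∈ S := by
  have hx : ∀ x : H, counit (R := ℂ) (x - algebraMap ℂ H (counit x)) = 0 := fun x => by simp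
  have hfa : ∀ c : ℂ, f (algebraMap ℂ H c) = algebraMap ℂ A c := fun c => by
    rw [Algebra.algebraMap_eq_smul_one, map_smul, hf1, Algebra.algebraMap_eq_smul_one]
  have hfa' : ∀ (c : ℂ) (z : H), f (algebraMap ℂ H c * z) = algebraMap ℂ A c * f z := fun c z => by
    rw [← Algebra.smul_def, map_smul, Algebra.smul_def]
  have h : f (x * y) - f x * f y =
      f ((x - algebraMap ℂ H (counit x)) * (y - algebraMap ℂ H (counit y))) -
        f (x - algebraMap ℂ H (counit x)) * f (y - algebraMap ℂ H (counit y)) := by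
    rw [sub_mul, mul_sub, mul_sub, mul_comm x (algebraMap ℂ H _)]
    simp only [map_sub, hfa, hfa']
    ring
  rw [h]
  exact S.sub_mem (hf _ (by simp)) (hS _ _ (hf _ (hx x)) (hf _ (hx y)))

lemma map_mul_of_mem_range {U V : Submodule ℂ H} {f : H →ₗ[ℂ] A} (φ : H →ₐ[ℂ] A)
    (h : ∀ x ∈ U, ∀ y ∈ V, f (x * y) = f x * f y) {s t : H ⊗[ℂ] H}
    (hs : s ∈ LinearMap.range (U.subtype.rTensor H))
    (ht : t ∈ LinearMap.range (V.subtype.rTensor H)) :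
    LinearMap.mul' ℂ A (TensorProduct.map f φ.toLinearMap (s * t)) =
      LinearMap.mul' ℂ A (TensorProduct.map f φ.toLinearMap s) *
        LinearMap.mul' ℂ A (TensorProduct.map f φ.toLinearMap t) := by
  obtain ⟨s, rfl⟩ := hs
  obtain ⟨t, rfl⟩ := ht
  induction s with
  | zero => simp
  | add a b ha hb => simp only [map_add, add_mul, ha, hb]
  | tmul a b =>
    induction t with
    | zero => simp
    | add c d hc hd => simp only [map_add, mul_add, hc, hd]
    | tmul c d =>
      simp only [LinearMap.rTensor_tmul, Submodule.subtype_apply, Algebra.TensorProduct.tmul_mul_tmul,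
        TensorProduct.map_tmul, LinearMap.mul'_apply, h a a.2 c c.2, AlgHom.toLinearMap_apply,
        map_mul]
      ring

end Defect

section Filtration

variable {F : ℕ → Submodule ℂ H} (hF : ∀ n, ∀ x ∈ F (n + 1),
  comul (R := ℂ) x - x ⊗ₜ[ℂ] 1 ∈ LinearMap.range ((F n).subtype.rTensor H))

include hF in
lemma conv_apply_of_mem {f : H →ₗ[ℂ] A} (g : H →ₗ[ℂ] A) {n : ℕ} (hf : ∀ x ∈ F n, f x = 0) {x : H}
    (hx : x ∈ F (n + 1)) : conv f g x = f x * g 1 := by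
  obtain ⟨t, ht⟩ := hF n x hx
  have h0 : f ∘ₗ (F n).subtype = 0 := LinearMap.ext fun y => hf y y.2
  have h : TensorProduct.map f g ((F n).subtype.rTensor H t) = 0 := by
    rw [LinearMap.rTensor, ← LinearMap.comp_apply, ← TensorProduct.map_comp, h0,
      TensorProduct.map_zero_left, LinearMap.zero_apply]
  rw [ht, map_sub, sub_eq_zero] at h
  rw [conv, LinearMap.comp_apply, LinearMap.comp_apply, h, TensorProduct.map_tmul,
    LinearMap.mul'_apply]

/-- A sequence of linear maps that is eventually constant on an exhaustive filtration has a
limit. -/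
lemma exists_limit (hmono : Monotone F) (hex : ∀ x, ∃ n, x ∈ F n) (u : ℕ → H →ₗ[ℂ] A)
    (hu : ∀ n, ∀ x ∈ F n, u (n + 1) x = u n x) :
    ∃ f : H →ₗ[ℂ] A, ∀ n, ∀ x ∈ F n, f x = u n x := by
  choose d hd using hex
  have hstable : ∀ {m n : ℕ}, m ≤ n → ∀ x ∈ F m, u n x = u m x := fun {m n} hmn x hx => by
    induction n, hmn using Nat.le_induction with
    | base => rfl
    | succ n hmn ih => rw [hu n x (hmono hmn hx), ih]
  have hlim : ∀ n, ∀ x ∈ F n, u (d x) x = u n x := fun n x hx => by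
    rcases le_total (d x) n with h | h
    · exact (hstable h x (hd x)).symm
    · exact hstable h x hx
  refine ⟨{ toFun := fun x => u (d x) x, map_add' := fun x y => ?_, map_smul' := fun c x => ?_ },
    hlim⟩
  · have hx := hmono (le_max_left (d x) (d y)) (hd x)
    have hy := hmono (le_max_right (d x) (d y)) (hd y)
    rw [hlim _ x hx, hlim _ y hy, hlim _ _ (add_mem hx hy), map_add]
  · rw [RingHom.id_apply, hlim _ _ ((F (d x)).smul_mem c (hd x)), map_smul]

include hF in
/-- The solution of the counterterm recursion. -/
lemma exists_counterterm (h0 : F 0 = ⊥) (hmono : Monotone F) (hex : ∀ x, ∃ n, x ∈ F n)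
    (π : A →ₗ[ℂ] A) (φ : H →ₐ[ℂ] A) :
    ∃ f : H →ₗ[ℂ] A, f 1 = 1 ∧
      ∀ x, counit (R := ℂ) x = 0 → f x = -π (conv f φ.toLinearMap x - f x) := by
  let e : H →ₗ[ℂ] A := Algebra.linearMap ℂ A ∘ₗ counit
  let ψ : H →ₗ[ℂ] A := φ.toLinearMap - e
  have hψ : ψ 1 = 0 := by simp [ψ, e]
  have hT : ∀ {n} {f g : H →ₗ[ℂ] A}, (∀ x ∈ F n, f x = g x) →
      ∀ x ∈ F (n + 1), conv f ψ x = conv g ψ x := fun {n f g} h x hx => by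
    rw [← sub_eq_zero, ← LinearMap.sub_apply, ← conv_sub_left,
      conv_apply_of_mem hF ψ (fun y hy => ?_) hx, hψ, mul_zero]
    rw [LinearMap.sub_apply, h y hy, sub_self]
  let u : ℕ → H →ₗ[ℂ] A := fun n => Nat.rec 0 (fun _ v => e - π ∘ₗ conv v ψ) n
  have hus : ∀ n, u (n + 1) = e - π ∘ₗ conv (u n) ψ := fun n => rfl
  have hu : ∀ n, ∀ x ∈ F n, u (n + 1) x = u n x := fun n => by
    induction n with
    | zero =>
      intro x hx
      rw [h0, Submodule.mem_bot] at hx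
      rw [hx, map_zero, map_zero]
    | succ n ih =>
      intro x hx
      change e x - π (conv (u (n + 1)) ψ x) = e x - π (conv (u n) ψ x)
      rw [hT ih x hx]
  obtain ⟨f, hf⟩ := exists_limit hmono hex u hu
  have hfix : ∀ x, f x = e x - π (conv f ψ x) := fun x => by
    obtain ⟨n, hn⟩ := hex x
    have hn' := hmono n.le_succ hn
    rw [hf (n + 1) x hn', hT (hf n) x hn', hus]
    rfl
  refine ⟨f, ?_, fun x hx => ?_⟩
  · rw [hfix, conv_one, hψ]
    simp [e]
  · have h : conv f ψ = conv f φ.toLinearMap - f := by rw [conv_sub_right, conv_counit]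
    have hex : e x = 0 := by simp [e, hx]
    conv_lhs => rw [hfix, h, hex, zero_sub, LinearMap.sub_apply]

include hF in
lemma map_mul_of_conv (h0 : F 0 = ⊥) (hex : ∀ x, ∃ n, x ∈ F n) {Aneg Apos : Submodule ℂ A}
    (hnegmul : ∀ x y : A, x ∈ Aneg → y ∈ Aneg → x * y ∈ Aneg)
    (hposmul : ∀ x y : A, x ∈ Apos → y ∈ Apos → x * y ∈ Apos)
    (hdisj : Disjoint Aneg Apos) (φ : H →ₐ[ℂ] A) {f : H →ₗ[ℂ] A} (hf1 : f 1 = 1)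
    (hneg : ∀ x, counit (R := ℂ) x = 0 → f x ∈ Aneg)
    (hpos : ∀ x, counit (R := ℂ) x = 0 → conv f φ.toLinearMap x ∈ Apos) (x y : H) :
    f (x * y) = f x * f y := by
  have hone : conv f φ.toLinearMap 1 = 1 := by rw [conv_one, hf1]; simp
  suffices h : ∀ m n, ∀ x ∈ F m, ∀ y ∈ F n, f (x * y) = f x * f y by
    obtain ⟨m, hm⟩ := hex x
    obtain ⟨n, hn⟩ := hex y
    exact h m n x hm y hn
  intro m
  induction m with
  | zero => intro n x hx y hy; rw [h0, Submodule.mem_bot] at hx; simp [hx]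
  | succ m ihm =>
    intro n
    induction n with
    | zero => intro x hx y hy; rw [h0, Submodule.mem_bot] at hy; simp [hy]
    | succ n ihn =>
      intro x hx y hy
      let G : H ⊗[ℂ] H →ₗ[ℂ] A := LinearMap.mul' ℂ A ∘ₗ TensorProduct.map f φ.toLinearMap
      have hs := hF m x hx
      have ht := hF n y hy
      set s := comul (R := ℂ) x - x ⊗ₜ[ℂ] 1
      set t := comul (R := ℂ) y - y ⊗ₜ[ℂ] 1
      have hΔx : comul (R := ℂ) x = x ⊗ₜ[ℂ] 1 + s := (add_sub_cancel _ _).symm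
      have hΔy : comul (R := ℂ) y = y ⊗ₜ[ℂ] 1 + t := (add_sub_cancel _ _).symm
      have htop : comul (R := ℂ) y ∈ LinearMap.range ((⊤ : Submodule ℂ H).subtype.rTensor H) :=
        LinearMap.rTensor_surjective H (fun z => ⟨⟨z, trivial⟩, rfl⟩) _
      have hGs : G (s * comul (R := ℂ) y) = G s * G (comul (R := ℂ) y) :=
        map_mul_of_mem_range φ (fun a ha b _ => by
          obtain ⟨k, hk⟩ := hex b
          exact ihm k a ha b hk) hs htop
      have hGt : G (x ⊗ₜ[ℂ] 1 * t) = G (x ⊗ₜ[ℂ] 1) * G t :=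
        map_mul_of_mem_range φ ihn ⟨⟨x, hx⟩ ⊗ₜ[ℂ] 1, rfl⟩ ht
      have hG1 : ∀ z : H, G (z ⊗ₜ[ℂ] 1) = f z := fun z => by simp [G]
      have hGG : G (x ⊗ₜ[ℂ] 1 * y ⊗ₜ[ℂ] 1) = f (x * y) := by
        rw [Algebra.TensorProduct.tmul_mul_tmul, one_mul, hG1]
      have hdefect : conv f φ.toLinearMap (x * y) -
          conv f φ.toLinearMap x * conv f φ.toLinearMap y = f (x * y) - f x * f y := by
        change G (comul (R := ℂ) (x * y)) - G (comul (R := ℂ) x) * G (comul (R := ℂ) y) = _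
        rw [Bialgebra.comul_mul, hΔx, add_mul, map_add, hGs, hΔy, mul_add, map_add, hGt, hGG,
          map_add, map_add, hG1, hG1]
        ring
      refine sub_eq_zero.mp (Submodule.disjoint_def.mp hdisj _
        (map_mul_sub_mem hnegmul hf1 hneg x y) ?_)
      rw [← hdefect]
      exact map_mul_sub_mem hposmul hone hpos x y

include hF in
lemma counterterm_unique (h0 : F 0 = ⊥) (hex : ∀ x, ∃ n, x ∈ F n) (π : A →ₗ[ℂ] A)
    (φ p q : H →ₐ[ℂ] A)
    (hp : ∀ x, counit (R := ℂ) x = 0 →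
      p x = -π (conv p.toLinearMap φ.toLinearMap x - p x))
    (hq : ∀ x, counit (R := ℂ) x = 0 →
      q x = -π (conv q.toLinearMap φ.toLinearMap x - q x)) : p = q := by
  let g : H →ₗ[ℂ] A := p.toLinearMap - q.toLinearMap
  have hg1 : g 1 = 0 := by simp [g]
  suffices h : ∀ n, ∀ x ∈ F n, g x = 0 by
    ext x
    obtain ⟨n, hn⟩ := hex x
    exact sub_eq_zero.mp (h n x hn)
  intro n
  induction n with
  | zero => intro x hx; rw [h0, Submodule.mem_bot] at hx; rw [hx, map_zero]
  | succ n ih =>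
    intro x hx
    let z : H := x - counit (R := ℂ) x • 1
    have hz : counit (R := ℂ) z = 0 := by simp [z]
    have hgz : g z = g x := by rw [map_sub, map_smul, hg1, smul_zero, sub_zero]
    have hconv : conv g φ.toLinearMap z = g z := by
      rw [hgz, map_sub, map_smul, conv_one, hg1, zero_mul, smul_zero, sub_zero,
        conv_apply_of_mem hF _ ih hx, AlgHom.toLinearMap_apply, map_one, mul_one]
    have hsub : p z - q z = -π (conv g φ.toLinearMap z - g z) := by
      rw [hp z hz, hq z hz, conv_sub_left]
      simp only [LinearMap.sub_apply, map_sub, g, AlgHom.toLinearMap_apply]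
      ring
    rw [hconv, sub_self, map_zero, neg_zero] at hsub
    exact hgz.symm.trans hsub

end Filtration

end Birkhoff

/-- Birkhoff decomposition: let `H` be a connected graded
commutative Hopf algebra over `ℂ`, and `A` a commutative `ℂ`-algebra with a
direct sum decomposition `A = A₋ ⊕ A₊` into subalgebras (`A₊` unital), with
`π` the linear idempotent projection onto `A₋` along `A₊` (a Rota-Baxter
operator of weight 1).  Every algebra homomorphism `φ : H → A` admits a unique
Birkhoff decomposition `φ = φ₋^{⋆−1} ⋆ φ₊`, where `φ₋, φ₊ : H → A` are algebra
homomorphisms with `φ₋(1) = 1`, `φ₋(x) ∈ A₋` and `φ₊(x) ∈ A₊` for `x` in the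
augmentation ideal, satisfying the recursions
`φ₋(Γ) = −π(φ(Γ) + Σ φ₋(γ')φ(γ'')) = −π((φ₋ ⋆ φ)(Γ) − φ₋(Γ))` and
`φ₊(Γ) = (id − π)(φ(Γ) + Σ φ₋(γ')φ(γ''))`, i.e. `φ₊ = φ₋ ⋆ φ`. -/
theorem birkhoff_decomposition
    (𝒜 : ℕ → Submodule ℂ H) [GradedAlgebra 𝒜] (hconn : 𝒜 0 = 1)
    (Aneg Apos : Submodule ℂ A)
    (hone : (1 : A) ∈ Apos)
    (hnegmul : ∀ x y : A, x ∈ Aneg → y ∈ Aneg → x * y ∈ Aneg)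
    (hposmul : ∀ x y : A, x ∈ Apos → y ∈ Apos → x * y ∈ Apos)
    (hcompl : IsCompl Aneg Apos)
    (π : A →ₗ[ℂ] A) (hπneg : ∀ x : A, π x ∈ Aneg) (hπpos : ∀ x : A, x - π x ∈ Apos)
    (φ : H →ₐ[ℂ] A) :
    ∃! p : (H →ₐ[ℂ] A) × (H →ₐ[ℂ] A),
      -- φ₋ and φ₊ land in A₋ resp. A₊ on the augmentation ideal
      (∀ x : H, Coalgebra.counit (R := ℂ) x = 0 → p.1 x ∈ Aneg) ∧
      (∀ x : H, Coalgebra.counit (R := ℂ) x = 0 → p.2 x ∈ Apos) ∧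
      -- the counterterm recursion φ₋(x) = −π((φ₋ ⋆ φ)(x) − φ₋(x))
      (∀ x : H, Coalgebra.counit (R := ℂ) x = 0 →
        p.1 x = -π ((conv p.1.toLinearMap φ.toLinearMap) x - p.1 x)) ∧
      -- φ₊ = φ₋ ⋆ φ
      conv p.1.toLinearMap φ.toLinearMap = p.2.toLinearMap ∧
      -- the decomposition φ = φ₋^{⋆−1} ⋆ φ₊ (with φ₋^{⋆−1} = φ₋ ∘ S)
      conv (p.1.toLinearMap ∘ₗ HopfAlgebra.antipode (R := ℂ)) p.2.toLinearMap
        = φ.toLinearMap := by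
  obtain ⟨F, h0, hmono, hex, hF⟩ := HopfSlice.exists_filtration hconn
  have hmono' : Monotone F := monotone_nat_of_le_succ hmono
  obtain ⟨f, hf1, hrec⟩ := Birkhoff.exists_counterterm hF h0 hmono' hex π φ
  have hneg : ∀ x, Coalgebra.counit (R := ℂ) x = 0 → f x ∈ Aneg := fun x hx => by
    rw [hrec x hx]
    exact Aneg.neg_mem (hπneg _)
  have hpos : ∀ x, Coalgebra.counit (R := ℂ) x = 0 → conv f φ.toLinearMap x ∈ Apos :=
    fun x hx => by
      have h := hπpos (conv f φ.toLinearMap x - f x)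
      rwa [sub_eq_add_neg, ← hrec x hx, sub_add_cancel] at h
  let p : H →ₐ[ℂ] A := AlgHom.ofLinearMap f hf1
    (Birkhoff.map_mul_of_conv hF h0 hex hnegmul hposmul hcompl.disjoint φ hf1 hneg hpos)
  let q : H →ₐ[ℂ] A := (WithConv.toConv p * WithConv.toConv φ).ofConv
  have hq : conv p.toLinearMap φ.toLinearMap = q.toLinearMap := rfl
  refine ⟨(p, q), ⟨hneg, hpos, hrec, hq, ?_⟩, ?_⟩
  · rw [← hq]
    exact Birkhoff.conv_antipode_conv _ p
  · rintro ⟨p', q'⟩ ⟨-, -, hrec', hq', -⟩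
    have hp : p' = p := Birkhoff.counterterm_unique hF h0 hex π φ p' p hrec' hrec
    subst hp
    exact Prod.ext rfl (AlgHom.toLinearMap_injective (hq'.symm.trans hq))
end

section
/- In the Birkhoff decomposition above, the maps φ₋ and φ₊ defined by the recursive formulas are algebra homomorphisms from H to A whenever φ is an algebra homomorphism and π is a Rota-Baxter operator of weight 1. -/
open TensorProduct

variable {H A : Type*} [CommRing H] [HopfAlgebra ℂ H] [CommRing A] [Algebra ℂ A]

open WithConv Coalgebra

section Coalgebra

variable {k C B : Type*} [Field k] [AddCommGroup C] [Module k C] [Coalgebra k C]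
  [CommRing B] [Algebra k B]

/-- Every element of a coalgebra over a field lies in a finite-dimensional left coideal. -/
lemma exists_finite_left_coideal (x : C) :
    ∃ s : Finset C, x ∈ Submodule.span k (s : Set C) ∧
      ∀ z ∈ s, ∃ h : C → C, comul (R := k) z = ∑ w ∈ s, h w ⊗ₜ[k] w := by
  classical
  let b := Module.Basis.ofVectorSpace k C
  let z := TensorProduct.equivFinsuppOfBasisLeft (N := C) b (comul (R := k) x)
  have hx : comul (R := k) x = ∑ i ∈ z.support, b i ⊗ₜ[k] z i := by
    rw [← (TensorProduct.equivFinsuppOfBasisLeft (N := C) b).symm_apply_apply (comul (R := k) x),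
      TensorProduct.equivFinsuppOfBasisLeft_symm_apply]
    rfl
  refine ⟨z.support.image z, ?_, ?_⟩
  · have h := congrArg (TensorProduct.lid k C) (rTensor_counit_comul (R := k) x)
    rw [hx] at h
    simp only [map_sum, LinearMap.rTensor_tmul, TensorProduct.lid_tmul, one_smul] at h
    rw [← h]
    exact Submodule.sum_mem _ fun i hi => Submodule.smul_mem _ _
      (Submodule.subset_span (Finset.mem_coe.mpr (Finset.mem_image_of_mem z hi)))
  · intro w hw
    obtain ⟨i, hi, rfl⟩ := Finset.mem_image.mp hw
    let p : C ⊗[k] (C ⊗[k] C) →ₗ[k] C ⊗[k] C :=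
      (TensorProduct.lid k _).toLinearMap ∘ₗ (b.coord i).rTensor (C ⊗[k] C)
    let q : C → C := fun y => TensorProduct.lid k C ((b.coord i).rTensor C (comul (R := k) y))
    have hq : ∀ (t : C ⊗[k] C) (v : C), p (TensorProduct.assoc k C C C (t ⊗ₜ v)) =
        TensorProduct.lid k C ((b.coord i).rTensor C t) ⊗ₜ v := by
      intro t v
      induction t with
      | zero => simp
      | tmul c d => simp [p, TensorProduct.smul_tmul']
      | add s t hs ht => simp only [TensorProduct.add_tmul, map_add, hs, ht]
    have hL : p ((comul (R := k)).lTensor C (comul (R := k) x)) = comul (R := k) (z i) := by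
      rw [hx]
      simp [p, Finsupp.single_apply]
      intro h
      simp [h]
    have hR : p ((comul (R := k)).lTensor C (comul (R := k) x)) =
        ∑ j ∈ z.support, q (b j) ⊗ₜ z j := by
      rw [← coassoc_apply, hx]
      simp only [map_sum, LinearMap.rTensor_tmul, hq, q]
    refine ⟨fun w => ∑ j ∈ z.support with z j = w, q (b j), ?_⟩
    rw [← hL, hR, ← Finset.sum_fiberwise_of_maps_to
      (fun j hj => Finset.mem_image_of_mem z hj) (fun j => q (b j) ⊗ₜ[k] z j)]
    refine Finset.sum_congr rfl fun w _ => ?_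
    rw [TensorProduct.sum_tmul]
    exact Finset.sum_congr rfl fun j hj => by rw [(Finset.mem_filter.mp hj).2]

/-- The `B`-linear extension to `B ⊗ C` of `x ↦ ∑ f x₍₁₎ ⊗ x₍₂₎`. -/
noncomputable def convTranslate (f : WithConv (C →ₗ[k] B)) : B ⊗[k] C →ₗ[B] B ⊗[k] C :=
  (f.ofConv.rTensor C ∘ₗ comul).liftBaseChange B

lemma convTranslate_one_tmul (f : WithConv (C →ₗ[k] B)) (x : C) :
    convTranslate f (1 ⊗ₜ x) = f.ofConv.rTensor C (comul x) := by
  simp [convTranslate]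

lemma convTranslate_one : convTranslate (1 : WithConv (C →ₗ[k] B)) = LinearMap.id := by
  refine TensorProduct.AlgebraTensorModule.curry_injective (LinearMap.ext_ring ?_)
  ext x
  simp [convTranslate_one_tmul, LinearMap.convOne_def, LinearMap.rTensor_comp]

lemma convTranslate_mul (f g : WithConv (C →ₗ[k] B)) :
    convTranslate (f * g) = convTranslate g ∘ₗ convTranslate f := by
  refine TensorProduct.AlgebraTensorModule.curry_injective (LinearMap.ext_ring ?_)
  ext x
  let Ψ : C ⊗[k] (C ⊗[k] C) →ₗ[k] B ⊗[k] C :=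
    (LinearMap.mul' k B).rTensor C ∘ₗ (TensorProduct.assoc k B B C).symm.toLinearMap ∘ₗ
      TensorProduct.map f.ofConv (g.ofConv.rTensor C)
  have hL : ∀ t : C ⊗[k] C, (f * g).ofConv.rTensor C t =
      Ψ (TensorProduct.assoc k C C C ((comul (R := k)).rTensor C t)) := by
    intro t
    induction t with
    | zero => simp
    | add s t hs ht => simp only [map_add, hs, ht]
    | tmul c d =>
      rw [LinearMap.rTensor_tmul, LinearMap.rTensor_tmul, ← (ℛ k c).eq]
      have := (ℛ k c).convMul_apply f g
      simp only [TensorProduct.sum_tmul, map_sum, TensorProduct.assoc_tmul]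
      change (f * g) c ⊗ₜ d = _
      rw [this]
      simp [Ψ, TensorProduct.sum_tmul]
  have hR : ∀ t : C ⊗[k] C, convTranslate g (f.ofConv.rTensor C t) =
      Ψ ((comul (R := k)).lTensor C t) := by
    intro t
    induction t with
    | zero => simp
    | add s t hs ht => simp only [map_add, hs, ht]
    | tmul c d =>
      rw [LinearMap.rTensor_tmul, LinearMap.lTensor_tmul, ← (ℛ k d).eq]
      simp [Ψ, convTranslate, ← (ℛ k d).eq, TensorProduct.tmul_sum, Finset.smul_sum,
        TensorProduct.smul_tmul']
  simp only [TensorProduct.AlgebraTensorModule.curry_apply,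
    TensorProduct.curry_apply, LinearMap.coe_restrictScalars, LinearMap.comp_apply,
    convTranslate_one_tmul, hL, hR, coassoc_apply]

lemma lTensor_counit_convTranslate (f : WithConv (C →ₗ[k] B)) (x : C) :
    TensorProduct.rid k B ((counit (R := k)).lTensor B (convTranslate f (1 ⊗ₜ x))) = f x := by
  rw [convTranslate_one_tmul, ← LinearMap.comp_apply, LinearMap.lTensor_comp_rTensor,
    ← LinearMap.rTensor_comp_lTensor, LinearMap.comp_apply, lTensor_counit_comul]
  simp

/-- The convolution algebra of linear maps from a coalgebra over a field to a commutative algebra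
is Dedekind-finite. -/
lemma convMul_eq_one_symm {f g : WithConv (C →ₗ[k] B)} (h : f * g = 1) : g * f = 1 := by
  ext x
  obtain ⟨s, hxs, hs⟩ := exists_finite_left_coideal (k := k) x
  let N : Submodule B (B ⊗[k] C) := Submodule.span B ((fun z => 1 ⊗ₜ z) '' (s : Set C))
  have hN : ∀ u : WithConv (C →ₗ[k] B), ∀ n ∈ N, convTranslate u n ∈ N := by
    intro u n hn
    refine (Submodule.span_le.mpr ?_ : N ≤ N.comap (convTranslate u)) hn
    rintro _ ⟨z, hz, rfl⟩
    obtain ⟨c, hc⟩ := hs z hz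
    simp only [Submodule.comap_coe, Set.mem_preimage, SetLike.mem_coe, convTranslate_one_tmul, hc,
      map_sum, LinearMap.rTensor_tmul]
    refine Submodule.sum_mem _ fun w hw => ?_
    have := N.smul_mem (u.ofConv (c w)) (Submodule.subset_span ⟨w, hw, rfl⟩)
    simpa [TensorProduct.smul_tmul'] using this
  have hxN : (1 : B) ⊗ₜ[k] x ∈ N := by
    have : Submodule.span k (s : Set C) ≤
        (N.restrictScalars k).comap (TensorProduct.mk k B C 1) :=
      Submodule.span_le.mpr fun z hz => Submodule.subset_span ⟨z, hz, rfl⟩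
    exact this hxs
  have hgf : ∀ n, convTranslate g (convTranslate f n) = n := fun n => by
    rw [← LinearMap.comp_apply, ← convTranslate_mul, h, convTranslate_one, LinearMap.id_apply]
  have : Module.Finite B N := Module.Finite.iff_fg.mpr
    (Submodule.fg_span (s.finite_toSet.image _))
  let G : N →ₗ[B] N := (convTranslate g).restrict (hN g)
  have hG : Function.Injective G := OrzechProperty.injective_of_surjective_endomorphism G
    fun n => ⟨⟨convTranslate f n, hN f n n.2⟩, Subtype.ext (hgf n)⟩
  have hfg : convTranslate f (convTranslate g (1 ⊗ₜ x)) = 1 ⊗ₜ x :=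
    congrArg Subtype.val (@hG ⟨_, hN f _ (hN g _ hxN)⟩ ⟨_, hxN⟩ (Subtype.ext (hgf _)))
  rw [← lTensor_counit_convTranslate, convTranslate_mul, LinearMap.comp_apply, hfg]
  simp [Algebra.algebraMap_eq_smul_one]

/-- If `f` and `g` differ from the convolution unit by maps into a multiplicatively closed
submodule, then so does their convolution product. -/
lemma convMul_sub_one_mem {N : Submodule k B} (hN : ∀ x y, x ∈ N → y ∈ N → x * y ∈ N)
    {f g : WithConv (C →ₗ[k] B)} (hf : ∀ x, (f - 1) x ∈ N) (hg : ∀ x, (g - 1) x ∈ N) (x : C) :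
    (f * g - 1) x ∈ N := by
  have h : f * g - 1 = (f - 1) + (g - 1) + (f - 1) * (g - 1) := by noncomm_ring
  rw [h]
  refine N.add_mem (N.add_mem (hf x) (hg x)) ?_
  change ((f - 1) * (g - 1)) x ∈ N
  rw [(ℛ k x).convMul_apply]
  exact N.sum_mem fun i _ => hN _ _ (hf _) (hg _)

/-- Two products of the form `1 + N` and `1 + P` agree only when both are trivial, provided `N`
and `P` are disjoint and multiplicatively closed. -/
lemma convMul_eq_one_of_disjoint {N P : Submodule k B} (hNP : Disjoint N P)
    (hN : ∀ x y, x ∈ N → y ∈ N → x * y ∈ N) (hP : ∀ x y, x ∈ P → y ∈ P → x * y ∈ P)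
    {f g p q : WithConv (C →ₗ[k] B)} (hf : ∀ x, (f - 1) x ∈ N) (hg : ∀ x, (g - 1) x ∈ N)
    (hp : ∀ x, (p - 1) x ∈ P) (hq : ∀ x, (q - 1) x ∈ P) (h : f * g = p * q) : f * g = 1 := by
  refine sub_eq_zero.mp (WithConv.ext (LinearMap.ext fun x => ?_))
  refine Submodule.disjoint_def.mp hNP _ (convMul_sub_one_mem hN hf hg x) ?_
  rw [h]
  exact convMul_sub_one_mem hP hp hq x

end Coalgebra

section HopfAlgebra

/-- In a commutative Hopf algebra the antipode reverses the comultiplication. -/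
lemma comul_antipode (x : H) :
    comul (R := ℂ) (HopfAlgebra.antipode ℂ x) =
      ∑ i ∈ (ℛ ℂ x).index, HopfAlgebra.antipode ℂ ((ℛ ℂ x).right i) ⊗ₜ[ℂ]
        HopfAlgebra.antipode ℂ ((ℛ ℂ x).left i) := by
  let l : WithConv (H →ₐ[ℂ] H ⊗[ℂ] H) := toConv Algebra.TensorProduct.includeLeft
  let r : WithConv (H →ₐ[ℂ] H ⊗[ℂ] H) := toConv Algebra.TensorProduct.includeRight
  have h : toConv (Bialgebra.comulAlgHom ℂ H) = l * r := by
    refine WithConv.ext (AlgHom.ext fun y => ?_)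
    change comul y = (toConv l.ofConv.toLinearMap * toConv r.ofConv.toLinearMap) y
    rw [(ℛ ℂ y).convMul_apply]
    simp [l, r, (ℛ ℂ y).eq]
  change (toConv (Bialgebra.comulAlgHom ℂ H))⁻¹ x = _
  rw [h, show (l * r)⁻¹ = r⁻¹ * l⁻¹ from mul_inv_rev l r]
  change (toConv (r⁻¹).ofConv.toLinearMap * toConv (l⁻¹).ofConv.toLinearMap) x = _
  rw [(ℛ ℂ x).convMul_apply]
  refine Finset.sum_congr rfl fun i _ => ?_
  change (1 ⊗ₜ[ℂ] HopfAlgebra.antipode ℂ ((ℛ ℂ x).left i)) *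
    (HopfAlgebra.antipode ℂ ((ℛ ℂ x).right i) ⊗ₜ[ℂ] 1) = _
  simp

/-- Precomposition with the antipode. -/
noncomputable def convAntipode (f : WithConv (H →ₗ[ℂ] A)) : WithConv (H →ₗ[ℂ] A) :=
  toConv (f.ofConv ∘ₗ HopfAlgebra.antipode ℂ)

lemma convAntipode_mul (f g : WithConv (H →ₗ[ℂ] A)) :
    convAntipode (f * g) = convAntipode g * convAntipode f := by
  ext x
  rw [(ℛ ℂ x).convMul_apply]
  change LinearMap.mul' ℂ A (TensorProduct.map f.ofConv g.ofConv
    (comul (HopfAlgebra.antipode ℂ x))) = _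
  rw [comul_antipode]
  simp [convAntipode, mul_comm]

lemma convAntipode_sub_one_mem {N : Submodule ℂ A} {f : WithConv (H →ₗ[ℂ] A)}
    (hf : ∀ x, (f - 1) x ∈ N) (x : H) : (convAntipode f - 1) x ∈ N := by
  have h := hf (HopfAlgebra.antipode ℂ x)
  simpa [convAntipode] using h

lemma algHom_mul_convAntipode (φ : H →ₐ[ℂ] A) :
    toConv φ.toLinearMap * convAntipode (toConv φ.toLinearMap) = 1 := by
  have h := LinearMap.algHom_comp_convMul_distrib φ (toConv LinearMap.id)
    (toConv (HopfAlgebra.antipode ℂ (A := H)))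
  rw [LinearMap.id_mul_antipode] at h
  refine WithConv.ext (Eq.trans h.symm ?_)
  ext x
  simp

/-- A linear map on `H` pulled back along the multiplication of `H`. -/
noncomputable def convPullback (f : WithConv (H →ₗ[ℂ] A)) : WithConv (H ⊗[ℂ] H →ₗ[ℂ] A) :=
  toConv (f.ofConv ∘ₗ LinearMap.mul' ℂ H)

lemma convPullback_mul (f g : WithConv (H →ₗ[ℂ] A)) :
    convPullback (f * g) = convPullback f * convPullback g :=
  WithConv.ext (LinearMap.convMul_comp_coalgHom_distrib f g (Bialgebra.mulCoalgHom ℂ H))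

lemma convPullback_one : convPullback (1 : WithConv (H →ₗ[ℂ] A)) = 1 := by
  refine WithConv.ext (TensorProduct.ext' fun a b => ?_)
  simp [convPullback, LinearMap.convOne_def, mul_comm]

lemma convPullback_sub_one_mem {N : Submodule ℂ A} {f : WithConv (H →ₗ[ℂ] A)}
    (hf : ∀ x, (f - 1) x ∈ N) (t : H ⊗[ℂ] H) : (convPullback f - 1) t ∈ N := by
  rw [← convPullback_one]
  exact hf (LinearMap.mul' ℂ H t)

/-- The map `a ⊗ b ↦ f a * f b`. -/
noncomputable def convSquare (f : WithConv (H →ₗ[ℂ] A)) : WithConv (H ⊗[ℂ] H →ₗ[ℂ] A) :=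
  toConv (LinearMap.mul' ℂ A ∘ₗ TensorProduct.map f.ofConv f.ofConv)

lemma convSquare_mul (f g : WithConv (H →ₗ[ℂ] A)) :
    convSquare (f * g) = convSquare f * convSquare g := by
  have h := LinearMap.algHom_comp_convMul_distrib (Algebra.TensorProduct.lmul' ℂ (S := A))
    (toConv (TensorProduct.map f.ofConv f.ofConv)) (toConv (TensorProduct.map g.ofConv g.ofConv))
  rw [TensorProduct.map_convMul_map] at h
  exact WithConv.ext h

lemma convSquare_algHom (φ : H →ₐ[ℂ] A) :
    convSquare (toConv φ.toLinearMap) = convPullback (toConv φ.toLinearMap) := by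
  refine WithConv.ext (TensorProduct.ext' fun a b => ?_)
  simp [convSquare, convPullback]

lemma convSquare_sub_one_mem {N : Submodule ℂ A} (hN : ∀ x y, x ∈ N → y ∈ N → x * y ∈ N)
    {f : WithConv (H →ₗ[ℂ] A)} (hf : ∀ x, (f - 1) x ∈ N) (t : H ⊗[ℂ] H) :
    (convSquare f - 1) t ∈ N := by
  induction t with
  | zero => exact (convSquare f - 1).ofConv.map_zero ▸ N.zero_mem
  | add s t hs ht => exact (convSquare f - 1).ofConv.map_add s t ▸ N.add_mem hs ht
  | tmul a b =>
    have h : (convSquare f - 1) (a ⊗ₜ b) = (f - 1) a * (f - 1) b +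
        counit (R := ℂ) a • (f - 1) b + counit (R := ℂ) b • (f - 1) a := by
      change f a * f b - algebraMap ℂ A (counit (R := ℂ) (a ⊗ₜ[ℂ] b)) =
        (f a - algebraMap ℂ A (counit a)) * (f b - algebraMap ℂ A (counit b)) +
        counit (R := ℂ) a • (f b - algebraMap ℂ A (counit b)) +
        counit (R := ℂ) b • (f a - algebraMap ℂ A (counit a))
      simp only [TensorProduct.counit_tmul, smul_eq_mul, map_mul, Algebra.smul_def]
      ring
    rw [h]
    exact N.add_mem (N.add_mem (hN _ _ (hf a) (hf b)) (N.smul_mem _ (hf b)))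
      (N.smul_mem _ (hf a))

/-- If `f` and `f ⋆ φ` differ from the unit by maps into disjoint subalgebras, then `f` is
multiplicative. -/
lemma map_mul_of_birkhoff {N P : Submodule ℂ A} (hNP : Disjoint N P)
    (hN : ∀ x y, x ∈ N → y ∈ N → x * y ∈ N) (hP : ∀ x y, x ∈ P → y ∈ P → x * y ∈ P)
    (φ : H →ₐ[ℂ] A) {f : WithConv (H →ₗ[ℂ] A)} (hf : ∀ x, (f - 1) x ∈ N)
    (hp : ∀ x, (f * toConv φ.toLinearMap - 1) x ∈ P) (a b : H) : f (a * b) = f a * f b := by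
  set Φ : WithConv (H →ₗ[ℂ] A) := toConv φ.toLinearMap
  have hΦ : Φ * convAntipode Φ = 1 := algHom_mul_convAntipode φ
  have hinv : f * convAntipode f = 1 := by
    refine convMul_eq_one_of_disjoint hNP hN hP hf (convAntipode_sub_one_mem hf) hp
      (convAntipode_sub_one_mem hp) ?_
    rw [convAntipode_mul, mul_assoc, ← mul_assoc Φ, hΦ, one_mul]
  have hsq : convSquare f * convPullback (convAntipode f) = 1 := by
    refine convMul_eq_one_of_disjoint hNP hN hP (convSquare_sub_one_mem hN hf)
      (convPullback_sub_one_mem (convAntipode_sub_one_mem hf)) (convSquare_sub_one_mem hP hp)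
      (convPullback_sub_one_mem (convAntipode_sub_one_mem hp)) ?_
    rw [convSquare_mul, convSquare_algHom, convAntipode_mul, convPullback_mul, mul_assoc,
      ← mul_assoc (convPullback _) (convPullback _), ← convPullback_mul, hΦ, convPullback_one,
      one_mul]
  have h : convSquare f = convPullback f := left_inv_eq_right_inv hsq <| by
    rw [← convPullback_mul, convMul_eq_one_symm hinv, convPullback_one]
  exact (congrArg (fun u => u (a ⊗ₜ[ℂ] b)) h).symm

/-- A unital linear map sending the augmentation ideal into `N` differs from the convolution
unit by a map into `N`. -/
lemma sub_one_mem_of_augmentation {N : Submodule ℂ A} {f : WithConv (H →ₗ[ℂ] A)} (h1 : f 1 = 1)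
    (h : ∀ x : H, counit (R := ℂ) x = 0 → f x ∈ N) (x : H) : (f - 1) x ∈ N := by
  have hx := h (x - algebraMap ℂ H (counit x)) (by simp)
  have h1' : f.ofConv 1 = 1 := h1
  simpa [Algebra.algebraMap_eq_smul_one, h1'] using hx

end HopfAlgebra

/-- in the Birkhoff decomposition of a character `φ : H → A` of a
connected graded commutative Hopf algebra `H` with respect to a Rota-Baxter
projection `π` of weight 1 (projection onto the subalgebra `A₋` along the
subalgebra `A₊`), the maps `φ₋` and `φ₊ = φ₋ ⋆ φ` defined by the recursive
formula `φ₋(Γ) = −π(φ(Γ) + Σ φ₋(Γ')φ(Γ'')) = −π((φ₋ ⋆ φ)(Γ) − φ₋(Γ))` on the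
augmentation ideal (with `φ₋(1) = 1`) are algebra homomorphisms from `H` to
`A`. -/
theorem birkhoff_factors_are_algebra_homs
    (𝒜 : ℕ → Submodule ℂ H) [GradedAlgebra 𝒜] (hconn : 𝒜 0 = 1)
    (Aneg Apos : Submodule ℂ A)
    (hone : (1 : A) ∈ Apos)
    (hnegmul : ∀ x y : A, x ∈ Aneg → y ∈ Aneg → x * y ∈ Aneg)
    (hposmul : ∀ x y : A, x ∈ Apos → y ∈ Apos → x * y ∈ Apos)
    (hcompl : IsCompl Aneg Apos)
    (π : A →ₗ[ℂ] A) (hπneg : ∀ x : A, π x ∈ Aneg) (hπpos : ∀ x : A, x - π x ∈ Apos)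
    (φ : H →ₐ[ℂ] A)
    (φm : H →ₗ[ℂ] A)
    (hφm1 : φm 1 = 1)
    -- the recursion defining the counterterm on the augmentation ideal:
    (hφmrec : ∀ x : H, Coalgebra.counit (R := ℂ) x = 0 →
      φm x = -π ((conv φm φ.toLinearMap) x - φm x)) :
    (∀ a b : H, φm (a * b) = φm a * φm b) ∧
    ((conv φm φ.toLinearMap) 1 = 1 ∧
      ∀ a b : H, (conv φm φ.toLinearMap) (a * b)
        = (conv φm φ.toLinearMap) a * (conv φm φ.toLinearMap) b) := by
  have hone' : conv φm φ.toLinearMap 1 = 1 := by simp [conv, Algebra.TensorProduct.one_def, hφm1]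
  have hneg : ∀ x : H, Coalgebra.counit (R := ℂ) x = 0 → φm x ∈ Aneg := fun x hx => by
    rw [hφmrec x hx]
    exact Aneg.neg_mem (hπneg _)
  have hpos : ∀ x : H, Coalgebra.counit (R := ℂ) x = 0 → conv φm φ.toLinearMap x ∈ Apos := by
    intro x hx
    have h := hπpos (conv φm φ.toLinearMap x - φm x)
    rwa [← neg_eq_iff_eq_neg.mpr (hφmrec x hx), sub_neg_eq_add, sub_add_cancel] at h
  have hmul : ∀ a b : H, φm (a * b) = φm a * φm b :=
    map_mul_of_birkhoff hcompl.disjoint hnegmul hposmul φ (f := toConv φm)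
      (sub_one_mem_of_augmentation hφm1 hneg) (sub_one_mem_of_augmentation hone' hpos)
  exact ⟨hmul, hone', map_mul (toConv (AlgHom.ofLinearMap φm hφm1 hmul) * toConv φ).ofConv⟩
end
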